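/- There exist absolute constants C, c > 0 such that the following holds. Let ‖·‖ be a 1-unconditional norm on ℝⁿ which is in position of minimal M, let X = (ℝⁿ, ‖·‖) and k = k(X) its critical dimension. Then for all t > 0, P( | ‖G‖ − E‖G‖ | > t · E‖G‖ ) ≤ C exp( −c · max{ t² k, t·√(k · log(e n / k)) } ), where G is a standard n-dimensional Gaussian vector. -/

import Mathlib

open MeasureTheory ProbabilityTheory Real

/-- The standard Gaussian measure `γₙ` on `ℝⁿ`. -/
noncomputable def stdGaussian (n : ℕ) : Measure (Fin n → ℝ) :=
  Measure.pi fun _ => gaussianReal 0 1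

/-- The Euclidean norm on `ℝⁿ`. -/
noncomputable def euclNorm {n : ℕ} (x : Fin n → ℝ) : ℝ :=
  Real.sqrt (∑ i, (x i) ^ 2)

/-- `b(X) = max{ N θ : ‖θ‖₂ = 1 }`, the Lipschitz constant of the norm `N`. -/
noncomputable def bConst {n : ℕ} (N : (Fin n → ℝ) → ℝ) : ℝ :=
  sSup {s | ∃ θ : Fin n → ℝ, euclNorm θ = 1 ∧ s = N θ}

/-- The critical dimension (Dvoretzky number) `k(X) = (E N(G) / b(X))²`. -/
noncomputable def critDim (n : ℕ) (N : (Fin n → ℝ) → ℝ) : ℝ :=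
  ((∫ x, N x ∂stdGaussian n) / bConst N) ^ 2

/-- A norm `N` on `ℝⁿ` is in position of minimal `M` if `E N(G) ≤ E N(TG)` for every
linear map `T` of determinant 1. -/
def MinimalMPosition (n : ℕ) (N : (Fin n → ℝ) → ℝ) : Prop :=
  ∀ T : (Fin n → ℝ) →ₗ[ℝ] (Fin n → ℝ), LinearMap.det T = 1 →
    (∫ x, N x ∂stdGaussian n) ≤ ∫ x, N (T x) ∂stdGaussian n

/-! ### Functional inequalities on the discrete cube -/

open scoped BigOperators

section Cube

variable {ι : Type*} [DecidableEq ι]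

/-- The point of the cube obtained by flipping the coordinate `i`. -/
def flipAt (i : ι) (x : ι → Bool) : ι → Bool := Function.update x i (!x i)

lemma flipAt_flipAt (i : ι) (x : ι → Bool) : flipAt i (flipAt i x) = x := by
  simp [flipAt]

lemma flipAt_comm (i j : ι) (x : ι → Bool) :
    flipAt i (flipAt j x) = flipAt j (flipAt i x) := by
  rcases eq_or_ne i j with rfl | h
  · rfl
  · simp [flipAt, h, h.symm, Function.update_comm h]

/-- The average of `g` over the two values of the coordinate `i`. -/
noncomputable def halfSum (i : ι) (g : (ι → Bool) → ℝ) : (ι → Bool) → ℝ :=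
  fun x => (g x + g (flipAt i x)) / 2

/-- Half the increment of `g` in the coordinate `i`. -/
noncomputable def halfDiff (i : ι) (g : (ι → Bool) → ℝ) : (ι → Bool) → ℝ :=
  fun x => (g x - g (flipAt i x)) / 2

/-- The average of `g` over the coordinates in a list. -/
noncomputable def avgList : List ι → ((ι → Bool) → ℝ) → (ι → Bool) → ℝ
  | [], g => g
  | i :: l, g => avgList l (halfSum i g)

lemma halfDiff_halfSum (i j : ι) (g : (ι → Bool) → ℝ) :
    halfDiff j (halfSum i g) = halfSum i (halfDiff j g) := by
  ext x
  simp only [halfDiff, halfSum, flipAt_comm i j]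
  ring

lemma halfDiff_comm (i j : ι) (g : (ι → Bool) → ℝ) :
    halfDiff j (halfDiff i g) = halfDiff i (halfDiff j g) := by
  ext x
  simp only [halfDiff, flipAt_comm i j]
  ring

lemma avgList_flipAt_of_invariant (l : List ι) {j : ι} {g : (ι → Bool) → ℝ}
    (hg : ∀ x, g (flipAt j x) = g x) (x : ι → Bool) :
    avgList l g (flipAt j x) = avgList l g x := by
  induction l generalizing g with
  | nil => exact hg x
  | cons i l ih =>
    refine ih fun y => ?_
    simp only [halfSum, flipAt_comm i j, hg]

lemma avgList_flipAt {l : List ι} {j : ι} (hj : j ∈ l) (g : (ι → Bool) → ℝ) (x : ι → Bool) :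
    avgList l g (flipAt j x) = avgList l g x := by
  induction l generalizing g with
  | nil => simp at hj
  | cons i l ih =>
    rcases List.mem_cons.1 hj with rfl | h
    · refine avgList_flipAt_of_invariant l (fun y => ?_) x
      simp only [halfSum, flipAt_flipAt]
      ring
    · exact ih h _

lemma eq_of_flipAt_invariant [Fintype ι] {g : (ι → Bool) → ℝ}
    (hg : ∀ j x, g (flipAt j x) = g x) (x y : ι → Bool) : g x = g y := by
  suffices h : ∀ s : Finset ι, ∀ x y : ι → Bool, (∀ i ∉ s, x i = y i) → g x = g y from
    h Finset.univ x y (by simp)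
  intro s
  induction s using Finset.induction_on with
  | empty =>
    intro x y h
    rw [funext fun i => h i (by simp)]
  | insert i s hi ih =>
    intro x y h
    by_cases hxy : x i = y i
    · refine ih x y fun k hk => ?_
      rcases eq_or_ne k i with rfl | hki
      · exact hxy
      · exact h k (by simp [hki, hk])
    · rw [← hg i x]
      refine ih _ y fun k hk => ?_
      rcases eq_or_ne k i with rfl | hki
      · simp only [flipAt, Function.update_self]
        revert hxy
        cases x k <;> cases y k <;> simp
      · simp only [flipAt, Function.update_of_ne hki]
        exact h k (by simp [hki, hk])

variable [Fintype ι]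

lemma expect_flipAt (i : ι) (g : (ι → Bool) → ℝ) : 𝔼 x, g (flipAt i x) = 𝔼 x, g x :=
  Fintype.expect_equiv
    (Function.Involutive.toPerm (flipAt i) (flipAt_flipAt i)) _ _ fun _ => rfl

lemma expect_halfSum (i : ι) (g : (ι → Bool) → ℝ) : 𝔼 x, halfSum i g x = 𝔼 x, g x := by
  simp only [halfSum, ← Finset.expect_div, Finset.expect_add_distrib, expect_flipAt]
  ring

lemma expect_avgList (l : List ι) (g : (ι → Bool) → ℝ) : 𝔼 x, avgList l g x = 𝔼 x, g x := by
  induction l generalizing g with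
  | nil => rfl
  | cons i l ih => rw [avgList, ih, expect_halfSum]

lemma avgList_univ (g : (ι → Bool) → ℝ) (x : ι → Bool) :
    avgList Finset.univ.toList g x = 𝔼 y, g y := by
  rw [← expect_avgList Finset.univ.toList g, ← Fintype.expect_const (ι := ι → Bool)
    (avgList Finset.univ.toList g x)]
  exact Finset.expect_congr rfl fun y _ =>
    eq_of_flipAt_invariant (fun j => avgList_flipAt (by simp) g) x y

lemma expect_sq_eq_halfSum_add_halfDiff (i : ι) (g : (ι → Bool) → ℝ) :
    𝔼 x, g x ^ 2 = 𝔼 x, halfSum i g x ^ 2 + 𝔼 x, halfDiff i g x ^ 2 := by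
  rw [← expect_halfSum i fun x => g x ^ 2, ← Finset.expect_add_distrib]
  refine Finset.expect_congr rfl fun x _ => ?_
  simp only [halfSum, halfDiff]
  ring

lemma two_point_entropy_le (a b : ℝ) :
    (a ^ 2 * log (a ^ 2) + b ^ 2 * log (b ^ 2)) / 2
      - (a ^ 2 + b ^ 2) / 2 * log ((a ^ 2 + b ^ 2) / 2) ≤ (a - b) ^ 2 := by
  have key : ∀ u m : ℝ, 0 ≤ u → 0 < m → u * log u - u * log m ≤ u * (u / m - 1) := by
    intro u m hu hm
    rcases hu.eq_or_lt with rfl | hu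
    · simp
    · rw [← mul_sub, ← log_div hu.ne' hm.ne']
      exact mul_le_mul_of_nonneg_left (log_le_sub_one_of_pos (div_pos hu hm)) hu.le
  set m := (a ^ 2 + b ^ 2) / 2 with hm
  rcases (show 0 ≤ m by positivity).eq_or_lt with h0 | h0
  · have ha : a = 0 := by nlinarith [sq_nonneg a, sq_nonneg b]
    have hb : b = 0 := by nlinarith [sq_nonneg a, sq_nonneg b]
    simp [ha, hb, hm]
  · have h1 := key (a ^ 2) m (sq_nonneg a) h0
    have h2 := key (b ^ 2) m (sq_nonneg b) h0
    have h3 : (a ^ 2 * (a ^ 2 / m - 1) + b ^ 2 * (b ^ 2 / m - 1)) / 2 ≤ (a - b) ^ 2 := by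
      have : (a ^ 2 * (a ^ 2 / m - 1) + b ^ 2 * (b ^ 2 / m - 1)) / 2
          = (a - b) ^ 2 * (a + b) ^ 2 / (4 * m) := by
        field_simp
        rw [hm]
        ring
      rw [this, div_le_iff₀ (by positivity)]
      refine mul_le_mul_of_nonneg_left ?_ (sq_nonneg _)
      nlinarith [sq_nonneg (a - b)]
    have h4 : (a ^ 2 * log m + b ^ 2 * log m) / 2 = m * log m := by rw [hm]; ring
    linarith

lemma sqrt_mean_sq_sub_sq_le (a b c d : ℝ) :
    (√((a ^ 2 + b ^ 2) / 2) - √((c ^ 2 + d ^ 2) / 2)) ^ 2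
      ≤ ((a - c) ^ 2 + (b - d) ^ 2) / 2 := by
  have h1 := Real.sq_sqrt (show 0 ≤ (a ^ 2 + b ^ 2) / 2 by positivity)
  have h2 := Real.sq_sqrt (show 0 ≤ (c ^ 2 + d ^ 2) / 2 by positivity)
  have h3 : (a * c + b * d) / 2 ≤ √((a ^ 2 + b ^ 2) / 2) * √((c ^ 2 + d ^ 2) / 2) := by
    rw [← Real.sqrt_mul (by positivity)]
    refine Real.le_sqrt_of_sq_le ?_
    nlinarith [sq_nonneg (a * d - b * c)]
  nlinarith

lemma expect_entropy_le_avgList (l : List ι) (g : (ι → Bool) → ℝ) :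
    𝔼 x, g x ^ 2 * log (g x ^ 2)
        - 𝔼 x, avgList l (fun y => g y ^ 2) x * log (avgList l (fun y => g y ^ 2) x)
      ≤ 4 * (l.map fun j => 𝔼 x, halfDiff j g x ^ 2).sum := by
  induction l generalizing g with
  | nil => simp [avgList]
  | cons i l ih =>
    set h : (ι → Bool) → ℝ := fun x => √(halfSum i (fun y => g y ^ 2) x) with hh
    have hsq : (fun x => h x ^ 2) = halfSum i (fun y => g y ^ 2) := by
      ext x
      exact Real.sq_sqrt (by simp only [halfSum]; positivity)
    have h1 : 𝔼 x, g x ^ 2 * log (g x ^ 2) - 𝔼 x, h x ^ 2 * log (h x ^ 2)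
        ≤ 4 * 𝔼 x, halfDiff i g x ^ 2 := by
      rw [← expect_halfSum i fun x => g x ^ 2 * log (g x ^ 2), ← Finset.expect_sub_distrib,
        Finset.mul_expect]
      refine Finset.expect_le_expect fun x _ => ?_
      have := two_point_entropy_le (g x) (g (flipAt i x))
      rw [congrFun hsq x]
      simp only [halfSum, halfDiff]
      linarith
    have h2 : (l.map fun j => 𝔼 x, halfDiff j h x ^ 2).sum
        ≤ (l.map fun j => 𝔼 x, halfDiff j g x ^ 2).sum := by
      refine List.sum_le_sum fun j _ => ?_
      rw [← expect_halfSum i fun x => halfDiff j g x ^ 2]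
      refine Finset.expect_le_expect fun x _ => ?_
      have := sqrt_mean_sq_sub_sq_le (g x) (g (flipAt i x)) (g (flipAt j x))
        (g (flipAt j (flipAt i x)))
      simp only [halfDiff, halfSum, hh, flipAt_comm i j]
      linarith
    have h3 := ih h
    rw [hsq] at h3
    simp only [avgList, List.map_cons, List.sum_cons]
    linarith

/-- Logarithmic Sobolev inequality on the cube. -/
lemma cube_log_sobolev (g : (ι → Bool) → ℝ) :
    𝔼 x, g x ^ 2 * log (g x ^ 2) - (𝔼 x, g x ^ 2) * log (𝔼 x, g x ^ 2)
      ≤ 4 * ∑ j, 𝔼 x, halfDiff j g x ^ 2 := by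
  have h := expect_entropy_le_avgList Finset.univ.toList g
  simpa only [avgList_univ, Fintype.expect_const, Finset.sum_map_toList] using h

lemma log_add_one_mul_expect_sq_le {R : ℝ} (hR : 0 < R) (g : (ι → Bool) → ℝ) :
    (log R + 1) * 𝔼 x, g x ^ 2
      ≤ 𝔼 x, g x ^ 2 * log (g x ^ 2) - (𝔼 x, g x ^ 2) * log (𝔼 x, g x ^ 2)
        + R * (𝔼 x, |g x|) ^ 2 := by
  set p := 𝔼 x, g x ^ 2 with hp
  have hp0 : 0 ≤ p := Finset.expect_nonneg fun x _ => sq_nonneg _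
  rcases hp0.eq_or_lt with h0 | h0
  · have hg : ∀ x, g x = 0 := by
      intro x
      have h1 := (Finset.expect_eq_zero_iff_of_nonneg
        (fun x _ => sq_nonneg (g x))).1 (hp ▸ h0.symm) x (Finset.mem_univ x)
      exact pow_eq_zero_iff (two_ne_zero) |>.1 h1
    simp [← h0, hg]
  · set c := √R * √p with hc
    have hc0 : 0 < c := by positivity
    have hc2 : c ^ 2 = R * p := by
      rw [hc, mul_pow, Real.sq_sqrt hR.le, Real.sq_sqrt h0.le]
    have h1 : ∀ x, g x ^ 2 * log (R * p) + 2 * g x ^ 2 - 2 * c * |g x|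
        ≤ g x ^ 2 * log (g x ^ 2) := by
      intro x
      rw [← hc2, ← sq_abs]
      rcases (abs_nonneg (g x)).eq_or_lt with hx | hx
      · simp [← hx]
      · have h2 := log_le_sub_one_of_pos (div_pos hc0 hx)
        rw [log_div hc0.ne' hx.ne'] at h2
        have h3 := mul_le_mul_of_nonneg_left h2 (sq_nonneg |g x|)
        have h4 : |g x| ^ 2 * (c / |g x| - 1) = c * |g x| - |g x| ^ 2 := by
          field_simp
        rw [log_pow, log_pow]
        push_cast
        nlinarith
    have h2 := Finset.expect_le_expect (s := Finset.univ) fun x _ => h1 x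
    rw [Finset.expect_sub_distrib, Finset.expect_add_distrib, ← Finset.expect_mul,
      ← Finset.mul_expect, ← Finset.mul_expect, ← hp, log_mul hR.ne' h0.ne'] at h2
    have h3 : 2 * c * (𝔼 x, |g x|) ≤ p + R * (𝔼 x, |g x|) ^ 2 := by
      have := sq_nonneg (√p - √R * 𝔼 x, |g x|)
      have e1 := Real.sq_sqrt hR.le
      have e2 := Real.sq_sqrt h0.le
      rw [sub_sq, mul_pow, e1, e2] at this
      rw [hc]
      linarith
    linarith

lemma expect_abs_halfDiff_halfSum_le (i j : ι) (g : (ι → Bool) → ℝ) :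
    𝔼 x, |halfDiff j (halfSum i g) x| ≤ 𝔼 x, |halfDiff j g x| := by
  rw [← expect_halfSum i fun x => |halfDiff j g x|, halfDiff_halfSum]
  refine Finset.expect_le_expect fun x _ => ?_
  simp only [halfSum, abs_div, Nat.abs_ofNat]
  gcongr
  exact abs_add_le _ _

lemma avgList_variance_le {R : ℝ} (hR : 0 < R) (l : List ι) (g : (ι → Bool) → ℝ) :
    (log R + 1) * (𝔼 x, g x ^ 2 - 𝔼 x, avgList l g x ^ 2)
      ≤ 4 * ∑ j, 𝔼 x, halfDiff j g x ^ 2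
        + R * (l.map fun j => (𝔼 x, |halfDiff j g x|) ^ 2).sum := by
  induction l generalizing g with
  | nil =>
    simp only [avgList, sub_self, mul_zero, List.map_nil, List.sum_nil, add_zero]
    exact mul_nonneg (by norm_num) (Finset.sum_nonneg fun j _ =>
      Finset.expect_nonneg fun x _ => sq_nonneg _)
  | cons i l ih =>
    have h1 := log_add_one_mul_expect_sq_le hR (halfDiff i g)
    have h2 := cube_log_sobolev (halfDiff i g)
    have h3 := ih (halfSum i g)
    have h4 := expect_sq_eq_halfSum_add_halfDiff i g
    have h5 : ∑ j, 𝔼 x, halfDiff j g x ^ 2 = ∑ j, 𝔼 x, halfDiff j (halfSum i g) x ^ 2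
        + ∑ j, 𝔼 x, halfDiff j (halfDiff i g) x ^ 2 := by
      rw [← Finset.sum_add_distrib]
      refine Finset.sum_congr rfl fun j _ => ?_
      rw [halfDiff_halfSum, halfDiff_comm i j]
      exact expect_sq_eq_halfSum_add_halfDiff i _
    have h6 : (l.map fun j => (𝔼 x, |halfDiff j (halfSum i g) x|) ^ 2).sum
        ≤ (l.map fun j => (𝔼 x, |halfDiff j g x|) ^ 2).sum := by
      refine List.sum_le_sum fun j _ => ?_
      exact pow_le_pow_left₀ (Finset.expect_nonneg fun x _ => abs_nonneg _)
        (expect_abs_halfDiff_halfSum_le i j g) 2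
    have h7 := mul_le_mul_of_nonneg_left h6 hR.le
    simp only [avgList, List.map_cons, List.sum_cons]
    rw [h4, h5]
    linarith

/-- A form of the Talagrand `L¹`-`L²` inequality on the cube. -/
lemma cube_variance_le {R : ℝ} (hR : 0 < R) (g : (ι → Bool) → ℝ) :
    (log R + 1) * (𝔼 x, g x ^ 2 - (𝔼 x, g x) ^ 2)
      ≤ 4 * ∑ j, 𝔼 x, halfDiff j g x ^ 2 + R * ∑ j, (𝔼 x, |halfDiff j g x|) ^ 2 := by
  have h := avgList_variance_le hR Finset.univ.toList g
  simpa only [avgList_univ, Fintype.expect_const, Finset.sum_map_toList] using h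

end Cube

/-! ### Exponential moments on finite probability spaces -/

section FiniteSpace

variable {Ω : Type*} [Fintype Ω]

lemma expect_exp_mul_sub (F : Ω → ℝ) (r μ : ℝ) :
    𝔼 x, exp (r * (F x - μ)) = exp (-(r * μ)) * 𝔼 x, exp (r * F x) := by
  rw [Finset.mul_expect]
  refine Finset.expect_congr rfl fun x _ => ?_
  rw [← exp_add]
  ring_nf

lemma expect_indicator_lt_abs_le {F : Ω → ℝ} {Λ μ B : ℝ} (hΛ : 0 ≤ Λ) (s : ℝ)
    (h1 : 𝔼 x, exp (Λ * (F x - μ)) ≤ B) (h2 : 𝔼 x, exp (Λ * (μ - F x)) ≤ B) :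
    𝔼 x, (if s < |F x - μ| then (1 : ℝ) else 0) ≤ 2 * B * exp (-(Λ * s)) := by
  calc 𝔼 x, (if s < |F x - μ| then (1 : ℝ) else 0)
      ≤ 𝔼 x, (exp (Λ * (F x - μ)) + exp (Λ * (μ - F x))) * exp (-(Λ * s)) := by
        refine Finset.expect_le_expect fun x _ => ?_
        split_ifs with h
        · rw [add_mul, ← exp_add, ← exp_add]
          rcases lt_abs.1 h with h | h
          · have := one_le_exp (show 0 ≤ Λ * (F x - μ) + -(Λ * s) by nlinarith)
            linarith [exp_pos (Λ * (μ - F x) + -(Λ * s))]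
          · have := one_le_exp (show 0 ≤ Λ * (μ - F x) + -(Λ * s) by nlinarith)
            linarith [exp_pos (Λ * (F x - μ) + -(Λ * s))]
        · positivity
    _ = (𝔼 x, exp (Λ * (F x - μ)) + 𝔼 x, exp (Λ * (μ - F x))) * exp (-(Λ * s)) := by
        rw [← Finset.expect_mul, Finset.expect_add_distrib]
    _ ≤ (2 * B) * exp (-(Λ * s)) :=
        mul_le_mul_of_nonneg_right (by linarith) (exp_pos _).le

variable [Nonempty Ω]

lemma exists_expect_exp_le {F : Ω → ℝ} (hF : 𝔼 x, F x = 0) :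
    ∃ A : ℝ, 0 < A ∧ ∀ r : ℝ, |r| * A ≤ 1 → 𝔼 x, exp (r * F x) ≤ exp (r ^ 2 * A ^ 2) := by
  obtain ⟨A, hA⟩ := (Set.finite_range fun x => |F x|).bddAbove
  have hA' : ∀ x, |F x| ≤ A := fun x => hA ⟨x, rfl⟩
  refine ⟨max A 1, by positivity, fun r hr => ?_⟩
  have h1 : ∀ x, exp (r * F x) ≤ 1 + r * F x + r ^ 2 * max A 1 ^ 2 := by
    intro x
    have h2 : |r * F x| ≤ |r| * max A 1 := by
      rw [abs_mul]
      exact mul_le_mul_of_nonneg_left ((hA' x).trans (le_max_left _ _)) (abs_nonneg r)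
    have h3 := (abs_le.1 (abs_exp_sub_one_sub_id_le (h2.trans hr))).2
    have h4 : (r * F x) ^ 2 ≤ r ^ 2 * max A 1 ^ 2 := by
      rw [← sq_abs (r * F x), ← sq_abs r, ← mul_pow]
      exact pow_le_pow_left₀ (abs_nonneg _) h2 2
    linarith
  calc 𝔼 x, exp (r * F x) ≤ 𝔼 x, (1 + r * F x + r ^ 2 * max A 1 ^ 2) :=
        Finset.expect_le_expect fun _ _ => h1 _
    _ = r ^ 2 * max A 1 ^ 2 + 1 := by
        rw [Finset.expect_add_distrib, Finset.expect_add_distrib, ← Finset.mul_expect, hF]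
        simp [add_comm]
    _ ≤ _ := add_one_le_exp _

lemma expect_exp_pos (F : Ω → ℝ) : 0 < 𝔼 x, exp (F x) :=
  Finset.expect_pos (fun _ _ => exp_pos _) Finset.univ_nonempty

/-- Exponential integrability from a Poincaré-type inequality for `exp (r F / 2)`, for a centred
function. -/
lemma expect_exp_le_of_variance_le_of_centered {F : Ω → ℝ} (hF : 𝔼 x, F x = 0) {Λ K : ℝ}
    (hΛ : 0 < Λ) (hK : 0 ≤ K) (hKΛ : K * Λ ^ 2 ≤ 1 / 2)
    (h : ∀ r, 0 < r → r ≤ Λ → 𝔼 x, exp (r * F x) - (𝔼 x, exp (r / 2 * F x)) ^ 2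
      ≤ K * r ^ 2 * 𝔼 x, exp (r * F x)) :
    𝔼 x, exp (Λ * F x) ≤ exp (4 * K * Λ ^ 2) := by
  have step : ∀ r, 0 < r → r ≤ Λ →
      𝔼 x, exp (r * F x) ≤ exp (2 * K * r ^ 2) * (𝔼 x, exp (r / 2 * F x)) ^ 2 := by
    intro r hr hrΛ
    set y := K * r ^ 2 with hy
    have hy0 : 0 ≤ y := by positivity
    have hy1 : y ≤ 1 / 2 := (mul_le_mul_of_nonneg_left (pow_le_pow_left₀ hr.le hrΛ 2) hK).trans hKΛ
    have h1 := h r hr hrΛ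
    have h2 : 1 ≤ exp (2 * y) * (1 - y) := by
      have := add_one_le_exp (2 * y)
      nlinarith
    have h3 := expect_exp_pos fun x => r * F x
    have h4 : (1 - y) * 𝔼 x, exp (r * F x) ≤ (𝔼 x, exp (r / 2 * F x)) ^ 2 := by linarith
    have h5 := mul_le_mul_of_nonneg_left h4 (exp_pos (2 * y)).le
    have h6 := mul_le_mul_of_nonneg_right h2 h3.le
    rw [show 2 * K * r ^ 2 = 2 * y by rw [hy]; ring]
    linarith
  have iter : ∀ N : ℕ, 𝔼 x, exp (Λ * F x) ≤ exp (4 * K * Λ ^ 2 * (1 - (1 / 2) ^ N))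
      * (𝔼 x, exp (Λ * (1 / 2) ^ N * F x)) ^ 2 ^ N := by
    intro N
    induction N with
    | zero => simp
    | succ N ih =>
      have h1 := step (Λ * (1 / 2) ^ N) (by positivity)
        (mul_le_of_le_one_right hΛ.le (pow_le_one₀ (by norm_num) (by norm_num)))
      have h2 := pow_le_pow_left₀ (expect_exp_pos fun x => Λ * (1 / 2) ^ N * F x).le h1 (2 ^ N)
      refine ih.trans ((mul_le_mul_of_nonneg_left h2 (exp_pos _).le).trans_eq ?_)
      rw [mul_pow, ← pow_mul, ← exp_nat_mul, ← mul_assoc, ← exp_add]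
      congr 2
      · have : (2 : ℝ) ^ N * (1 / 2) ^ N = 1 := by rw [← mul_pow]; norm_num
        push_cast
        rw [pow_succ]
        linear_combination (2 * K * Λ ^ 2 * (1 / 2) ^ N) * this
      · rw [pow_succ, show Λ * (1 / 2) ^ N / 2 = Λ * ((1 / 2) ^ N * (1 / 2)) by ring]
      · ring
  obtain ⟨A, hA0, hA⟩ := exists_expect_exp_le hF
  have hlim : Filter.Tendsto (fun N : ℕ => exp (4 * K * Λ ^ 2 * (1 - (1 / 2) ^ N)
      + Λ ^ 2 * A ^ 2 * (1 / 2) ^ N)) Filter.atTop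
      (nhds (exp (4 * K * Λ ^ 2 * (1 - 0) + Λ ^ 2 * A ^ 2 * 0))) := by
    have := tendsto_pow_atTop_nhds_zero_of_lt_one (r := (1 / 2 : ℝ)) (by norm_num) (by norm_num)
    refine (continuous_exp.tendsto _).comp ?_
    exact ((this.const_sub 1).const_mul _).add (this.const_mul _)
  rw [sub_zero, mul_one, mul_zero, add_zero] at hlim
  refine ge_of_tendsto hlim ?_
  have hev : ∀ᶠ N : ℕ in Filter.atTop, (1 / 2 : ℝ) ^ N < 1 / (Λ * A) :=
    (tendsto_pow_atTop_nhds_zero_of_lt_one (by norm_num) (by norm_num)).eventually_lt_const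
      (by positivity)
  filter_upwards [hev] with N hN
  refine (iter N).trans ?_
  have h1 : |Λ * (1 / 2) ^ N| * A ≤ 1 := by
    rw [abs_of_pos (by positivity)]
    rw [lt_div_iff₀ (by positivity)] at hN
    linarith
  have h2 := pow_le_pow_left₀ (expect_exp_pos fun x => Λ * (1 / 2) ^ N * F x).le
    (hA (Λ * (1 / 2) ^ N) h1) (2 ^ N)
  refine (mul_le_mul_of_nonneg_left h2 (exp_pos _).le).trans_eq ?_
  rw [← exp_nat_mul, ← exp_add]
  congr 2
  have : (2 : ℝ) ^ N * (1 / 2) ^ N = 1 := by rw [← mul_pow]; norm_num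
  push_cast
  linear_combination (Λ ^ 2 * A ^ 2 * (1 / 2) ^ N) * this

lemma expect_exp_le_of_variance_le {F : Ω → ℝ} {Λ K : ℝ}
    (hΛ : 0 < Λ) (hK : 0 ≤ K) (hKΛ : K * Λ ^ 2 ≤ 1 / 2)
    (h : ∀ r, 0 < r → r ≤ Λ → 𝔼 x, exp (r * F x) - (𝔼 x, exp (r / 2 * F x)) ^ 2
      ≤ K * r ^ 2 * 𝔼 x, exp (r * F x)) :
    𝔼 x, exp (Λ * (F x - 𝔼 y, F y)) ≤ exp (4 * K * Λ ^ 2) := by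
  obtain ⟨μ, hμ⟩ : ∃ μ, μ = 𝔼 y, F y := ⟨_, rfl⟩
  rw [← hμ]
  refine expect_exp_le_of_variance_le_of_centered (F := fun x => F x - μ) ?_ hΛ hK hKΛ ?_
  · rw [Finset.expect_sub_distrib, Fintype.expect_const, ← hμ, sub_self]
  · intro r hr hrΛ
    have h1 := mul_le_mul_of_nonneg_left (h r hr hrΛ) (exp_pos (-(r * μ))).le
    have h2 : exp (-(r / 2 * μ)) ^ 2 = exp (-(r * μ)) := by
      rw [← exp_nat_mul]
      congr 1
      push_cast
      ring
    rw [expect_exp_mul_sub, expect_exp_mul_sub, mul_pow, h2]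
    linarith

/-- The Herbst argument for a centred function. -/
lemma expect_exp_le_of_entropy_le_of_centered {F : Ω → ℝ} (hF : 𝔼 x, F x = 0) {Λ K : ℝ}
    (hΛ : 0 < Λ) (hK : 0 ≤ K)
    (h : ∀ r, 0 < r → r ≤ Λ → 𝔼 x, exp (r * F x) * (r * F x)
      - (𝔼 x, exp (r * F x)) * log (𝔼 x, exp (r * F x)) ≤ K * r ^ 2 * 𝔼 x, exp (r * F x)) :
    𝔼 x, exp (Λ * F x) ≤ exp (K * Λ ^ 2) := by
  set Z : ℝ → ℝ := fun r => 𝔼 x, exp (r * F x) with hZ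
  have hZ0 : ∀ r, 0 < Z r := fun r => expect_exp_pos fun x => r * F x
  have hZd : ∀ r, HasDerivAt Z (𝔼 x, exp (r * F x) * F x) r := by
    intro r
    have h1 : ∀ x, HasDerivAt (fun r => exp (r * F x)) (exp (r * F x) * F x) r := by
      intro x
      simpa using ((hasDerivAt_id r).mul_const (F x)).exp
    simp only [hZ, Finset.expect_eq_sum_div_card]
    exact (HasDerivAt.fun_sum fun x _ => h1 x).div_const _
  set ψ : ℝ → ℝ := fun r => log (Z r) / r - K * r with hψ
  have hψd : ∀ r, 0 < r → HasDerivAt ψ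
      (((𝔼 x, exp (r * F x) * F x) / Z r * r - log (Z r) * 1) / r ^ 2 - K * 1) r := by
    intro r hr
    exact (((hZd r).log (hZ0 r).ne').div (hasDerivAt_id r) hr.ne').sub
      ((hasDerivAt_id r).const_mul K)
  have hanti : AntitoneOn ψ (Set.Ioc 0 Λ) := by
    refine antitoneOn_of_deriv_nonpos (convex_Ioc 0 Λ)
      (fun r hr => (hψd r hr.1).continuousAt.continuousWithinAt) ?_ ?_
    · intro r hr
      rw [interior_Ioc] at hr
      exact (hψd r hr.1).differentiableAt.differentiableWithinAt
    · intro r hr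
      rw [interior_Ioc] at hr
      rw [(hψd r hr.1).deriv, mul_one, mul_one, sub_nonpos, div_le_iff₀ (pow_pos hr.1 2)]
      have h1 := h r hr.1 hr.2.le
      have h2 : 𝔼 x, exp (r * F x) * (r * F x) = (𝔼 x, exp (r * F x) * F x) * r := by
        rw [Finset.expect_mul]
        exact Finset.expect_congr rfl fun x _ => by ring
      rw [h2] at h1
      change _ - Z r * log (Z r) ≤ K * r ^ 2 * Z r at h1
      have h3 := hZ0 r
      have h4 : (𝔼 x, exp (r * F x) * F x) / Z r * r - log (Z r)
          = ((𝔼 x, exp (r * F x) * F x) * r - Z r * log (Z r)) / Z r := by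
        field_simp
      rw [h4, div_le_iff₀ h3]
      exact h1
  obtain ⟨A, hA0, hA⟩ := exists_expect_exp_le hF
  have hlim : Filter.Tendsto (fun r : ℝ => r * A ^ 2) (nhdsWithin 0 (Set.Ioi 0)) (nhds 0) := by
    have : Filter.Tendsto (fun r : ℝ => r * A ^ 2) (nhds 0) (nhds (0 * A ^ 2)) :=
      (continuous_id.mul continuous_const).tendsto 0
    rw [zero_mul] at this
    exact this.mono_left nhdsWithin_le_nhds
  have hψΛ : ψ Λ ≤ 0 := by
    refine ge_of_tendsto hlim ?_
    filter_upwards [Ioc_mem_nhdsGT (show 0 < min Λ (1 / A) by positivity)] with r hr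
    have hr0 : 0 < r := hr.1
    refine (hanti ⟨hr0, hr.2.trans (min_le_left _ _)⟩ ⟨hΛ, le_rfl⟩
      (hr.2.trans (min_le_left _ _))).trans ?_
    have h1 : |r| * A ≤ 1 := by
      rw [abs_of_pos hr0, ← le_div_iff₀ hA0]
      exact hr.2.trans (min_le_right _ _)
    have h2 : log (Z r) ≤ r ^ 2 * A ^ 2 := (log_le_iff_le_exp (hZ0 r)).2 (hA r h1)
    have h3 : log (Z r) / r ≤ r * A ^ 2 := by
      rw [div_le_iff₀ hr0]
      linarith
    simp only [hψ]
    have : 0 ≤ K * r := by positivity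
    linarith
  rw [← log_le_iff_le_exp (hZ0 Λ)]
  simp only [hψ, sub_nonpos] at hψΛ
  rw [div_le_iff₀ hΛ] at hψΛ
  linarith

/-- The Herbst argument. -/
lemma expect_exp_le_of_entropy_le {F : Ω → ℝ} {Λ K : ℝ} (hΛ : 0 < Λ) (hK : 0 ≤ K)
    (h : ∀ r, 0 < r → r ≤ Λ → 𝔼 x, exp (r * F x) * (r * F x)
      - (𝔼 x, exp (r * F x)) * log (𝔼 x, exp (r * F x)) ≤ K * r ^ 2 * 𝔼 x, exp (r * F x)) :
    𝔼 x, exp (Λ * (F x - 𝔼 y, F y)) ≤ exp (K * Λ ^ 2) := by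
  obtain ⟨μ, hμ⟩ : ∃ μ, μ = 𝔼 y, F y := ⟨_, rfl⟩
  rw [← hμ]
  refine expect_exp_le_of_entropy_le_of_centered (F := fun x => F x - μ) ?_ hΛ hK ?_
  · rw [Finset.expect_sub_distrib, Fintype.expect_const, ← hμ, sub_self]
  · intro r hr hrΛ
    have h1 := mul_le_mul_of_nonneg_left (h r hr hrΛ) (exp_pos (-(r * μ))).le
    have h2 : 𝔼 x, exp (r * (F x - μ)) * (r * (F x - μ))
        = exp (-(r * μ)) * (𝔼 x, exp (r * F x) * (r * F x)
          - r * μ * 𝔼 x, exp (r * F x)) := by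
      rw [Finset.mul_expect, ← Finset.expect_sub_distrib, Finset.mul_expect]
      refine Finset.expect_congr rfl fun x _ => ?_
      rw [show r * (F x - μ) = -(r * μ) + r * F x by ring, exp_add]
      ring
    rw [h2, expect_exp_mul_sub, log_mul (exp_pos _).ne' (expect_exp_pos fun x => r * F x).ne', log_exp]
    linarith

end FiniteSpace

/-! ### Concentration on the discrete cube -/

section CubeConcentration

variable {ι : Type*} [DecidableEq ι]

/-- `p i x` dominates half of the decrease of `F` when the coordinate `i` of `x` is flipped, and
`β` dominates half of all the increments of `F`. -/
structure IsDecreaseBound (F : (ι → Bool) → ℝ) (p : ι → (ι → Bool) → ℝ) (β : ℝ) : Prop where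
  nonneg : ∀ i x, 0 ≤ p i x
  sub_le : ∀ i x, F x - F (flipAt i x) ≤ 2 * p i x
  abs_sub_le : ∀ i x, |F x - F (flipAt i x)| ≤ 2 * β

lemma expect_sq_le_mul {Ω : Type*} [Fintype Ω] {u v : Ω → ℝ} (hv : ∀ x, 0 ≤ v x) :
    (𝔼 x, u x * v x) ^ 2 ≤ (𝔼 x, v x) * 𝔼 x, u x ^ 2 * v x := by
  have h := Finset.sum_mul_sq_le_sq_mul_sq Finset.univ (fun x => √(v x))
    (fun x => u x * √(v x))
  have h1 : ∀ x, √(v x) * (u x * √(v x)) = u x * v x := fun x => by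
    rw [mul_left_comm, Real.mul_self_sqrt (hv x)]
  have h2 : ∀ x, √(v x) ^ 2 = v x := fun x => Real.sq_sqrt (hv x)
  simp only [h1, h2, mul_pow] at h
  simp only [Finset.expect_eq_sum_div_card, div_pow]
  rw [div_mul_div_comm, ← sq]
  gcongr

namespace IsDecreaseBound

variable {F : (ι → Bool) → ℝ} {p : ι → (ι → Bool) → ℝ} {β : ℝ}

lemma abs_halfDiff_le (hp : IsDecreaseBound F p β) (i : ι) (x : ι → Bool) :
    |halfDiff i F x| ≤ p i x + p i (flipAt i x) := by
  have h1 := hp.sub_le i x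
  have h2 := hp.sub_le i (flipAt i x)
  have h3 := hp.nonneg i x
  have h4 := hp.nonneg i (flipAt i x)
  rw [flipAt_flipAt] at h2
  rw [halfDiff, abs_le]
  constructor <;> linarith

lemma exp_flipAt_le (hp : IsDecreaseBound F p β) (r : ℝ) (i : ι) (x : ι → Bool) :
    exp (r * F (flipAt i x)) ≤ exp (2 * |r| * β) * exp (r * F x) := by
  rw [← exp_add, exp_le_exp]
  have h1 : |r * (F x - F (flipAt i x))| ≤ |r| * (2 * β) := by
    rw [abs_mul]
    exact mul_le_mul_of_nonneg_left (hp.abs_sub_le i x) (abs_nonneg r)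
  have := (abs_le.1 h1).1
  linarith

lemma abs_halfDiff_exp_le (hp : IsDecreaseBound F p β) (r : ℝ) (i : ι) (x : ι → Bool) :
    |halfDiff i (fun y => exp (r / 2 * F y)) x|
      ≤ |r| / 2 * exp (|r| * β) * (exp (r / 2 * F x) * |halfDiff i F x|) := by
  have key : ∀ u v : ℝ, |exp u - exp v| ≤ |u - v| * max (exp u) (exp v) := by
    have aux : ∀ u v : ℝ, v ≤ u → exp u - exp v ≤ (u - v) * exp u := by
      intro u v h
      have h1 := add_one_le_exp (v - u)
      have h2 := mul_le_mul_of_nonneg_right h1 (exp_pos u).le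
      rw [← exp_add, sub_add_cancel] at h2
      linarith
    intro u v
    rcases le_total v u with h | h
    · rw [abs_of_nonneg (sub_nonneg.2 (exp_le_exp.2 h)), abs_of_nonneg (sub_nonneg.2 h),
        max_eq_left (exp_le_exp.2 h)]
      exact aux u v h
    · rw [abs_of_nonpos (sub_nonpos.2 (exp_le_exp.2 h)), abs_of_nonpos (sub_nonpos.2 h),
        max_eq_right (exp_le_exp.2 h), neg_sub, neg_sub]
      exact aux v u h
  have hβ : 0 ≤ β := by
    have := (abs_nonneg _).trans (hp.abs_sub_le i x)
    linarith
  have h1 := key (r / 2 * F x) (r / 2 * F (flipAt i x))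
  have h2 := hp.exp_flipAt_le (r / 2) i x
  have h3 : 2 * |r / 2| * β = |r| * β := by
    rw [abs_div, Nat.abs_ofNat]
    ring
  rw [h3] at h2
  have h4 : max (exp (r / 2 * F x)) (exp (r / 2 * F (flipAt i x)))
      ≤ exp (|r| * β) * exp (r / 2 * F x) := by
    refine max_le ?_ h2
    exact le_mul_of_one_le_left (exp_pos _).le (one_le_exp (by positivity))
  have h5 : |r / 2 * F x - r / 2 * F (flipAt i x)| = |r| * |halfDiff i F x| := by
    rw [halfDiff, ← abs_mul]
    congr 1
    ring
  rw [h5] at h1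
  rw [halfDiff, abs_div, Nat.abs_ofNat, div_le_iff₀ two_pos]
  refine h1.trans ((mul_le_mul_of_nonneg_left h4 (by positivity)).trans_eq ?_)
  ring

lemma sq_exp_le_two {r : ℝ} (hr : exp (2 * |r| * β) ≤ 2) : exp (|r| * β) ^ 2 ≤ 2 := by
  rw [← exp_nat_mul]
  refine le_trans (le_of_eq ?_) hr
  congr 1
  push_cast
  ring

lemma exp_half_sq (r t : ℝ) : exp (r / 2 * t) ^ 2 = exp (r * t) := by
  rw [← exp_nat_mul]
  congr 1
  push_cast
  ring

variable [Fintype ι]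

lemma expect_exp_mul_flipAt_le (hp : IsDecreaseBound F p β) {r : ℝ}
    (hr : exp (2 * |r| * β) ≤ 2) (i : ι) {q : (ι → Bool) → ℝ} (hq : ∀ x, 0 ≤ q x) :
    𝔼 x, exp (r * F x) * q (flipAt i x) ≤ 2 * 𝔼 x, exp (r * F x) * q x := by
  rw [← expect_flipAt i, Finset.mul_expect]
  refine Finset.expect_le_expect fun x _ => ?_
  rw [flipAt_flipAt, ← mul_assoc]
  refine mul_le_mul_of_nonneg_right ((hp.exp_flipAt_le r i x).trans ?_) (hq x)
  exact mul_le_mul_of_nonneg_right hr (exp_pos _).le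

lemma sum_expect_halfDiff_sq_le (hp : IsDecreaseBound F p β) {r V : ℝ}
    (hr : exp (2 * |r| * β) ≤ 2) (hV : ∀ x, ∑ i, p i x ^ 2 ≤ V) :
    ∑ i, 𝔼 x, halfDiff i (fun y => exp (r / 2 * F y)) x ^ 2
      ≤ 3 * r ^ 2 * V * 𝔼 x, exp (r * F x) := by
  have h1 : ∀ i, 𝔼 x, halfDiff i (fun y => exp (r / 2 * F y)) x ^ 2
      ≤ 3 * r ^ 2 * 𝔼 x, exp (r * F x) * p i x ^ 2 := by
    intro i
    have h2 : ∀ x, halfDiff i (fun y => exp (r / 2 * F y)) x ^ 2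
        ≤ r ^ 2 * (exp (r * F x) * p i x ^ 2 + exp (r * F x) * p i (flipAt i x) ^ 2) := by
      intro x
      have h3 := pow_le_pow_left₀ (abs_nonneg _) (hp.abs_halfDiff_exp_le r i x) 2
      rw [sq_abs, mul_pow, mul_pow, mul_pow, exp_half_sq, div_pow, sq_abs] at h3
      have h4 := pow_le_pow_left₀ (abs_nonneg _) (hp.abs_halfDiff_le i x) 2
      have h5 : (p i x + p i (flipAt i x)) ^ 2 ≤ 2 * (p i x ^ 2 + p i (flipAt i x) ^ 2) := by
        nlinarith [sq_nonneg (p i x - p i (flipAt i x))]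
      have h6 := mul_le_mul_of_nonneg_left (h4.trans h5) (exp_pos (r * F x)).le
      calc _ ≤ _ := h3
        _ ≤ r ^ 2 / 2 ^ 2 * 2
            * (exp (r * F x) * (2 * (p i x ^ 2 + p i (flipAt i x) ^ 2))) := by
          gcongr
          exact sq_exp_le_two hr
        _ = _ := by ring
    have h3 := hp.expect_exp_mul_flipAt_le hr i fun x => sq_nonneg (p i x)
    calc _ ≤ 𝔼 x, r ^ 2 * (exp (r * F x) * p i x ^ 2 + exp (r * F x) * p i (flipAt i x) ^ 2) :=
          Finset.expect_le_expect fun x _ => h2 x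
      _ = r ^ 2 * (𝔼 x, exp (r * F x) * p i x ^ 2
            + 𝔼 x, exp (r * F x) * p i (flipAt i x) ^ 2) := by
          rw [← Finset.mul_expect, Finset.expect_add_distrib]
      _ ≤ r ^ 2 * (3 * 𝔼 x, exp (r * F x) * p i x ^ 2) :=
          mul_le_mul_of_nonneg_left (by linarith) (sq_nonneg r)
      _ = _ := by ring
  calc _ ≤ ∑ i, 3 * r ^ 2 * 𝔼 x, exp (r * F x) * p i x ^ 2 := Finset.sum_le_sum fun i _ => h1 i
    _ = 3 * r ^ 2 * 𝔼 x, exp (r * F x) * ∑ i, p i x ^ 2 := by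
        rw [← Finset.mul_sum, ← Finset.expect_sum_comm]
        simp only [Finset.mul_sum]
    _ ≤ 3 * r ^ 2 * 𝔼 x, exp (r * F x) * V := by
        gcongr with x
        exact hV x
    _ = _ := by
        rw [← Finset.expect_mul]
        ring

lemma sum_expect_abs_halfDiff_sq_le [Nonempty ι] (hp : IsDecreaseBound F p β) {r a S : ℝ}
    (hr : exp (2 * |r| * β) ≤ 2) (ha : ∀ i, 𝔼 x, p i x ≤ a) (hS : ∀ x, ∑ i, p i x ≤ S) :
    ∑ i, (𝔼 x, |halfDiff i (fun y => exp (r / 2 * F y)) x|) ^ 2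
      ≤ 3 * r ^ 2 * a * S * 𝔼 x, exp (r * F x) := by
  obtain ⟨i₀⟩ := ‹Nonempty ι›
  have ha0 : 0 ≤ a := (Finset.expect_nonneg fun x _ => hp.nonneg i₀ x).trans (ha i₀)
  have h1 : ∀ i, (𝔼 x, |halfDiff i (fun y => exp (r / 2 * F y)) x|) ^ 2
      ≤ 3 * r ^ 2 * a * 𝔼 x, exp (r * F x) * p i x := by
    intro i
    have h2 : 𝔼 x, |halfDiff i (fun y => exp (r / 2 * F y)) x|
        ≤ |r| / 2 * exp (|r| * β) * 𝔼 x, exp (r / 2 * F x) * |halfDiff i F x| := by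
      rw [Finset.mul_expect]
      exact Finset.expect_le_expect fun x _ => hp.abs_halfDiff_exp_le r i x
    have h3 := pow_le_pow_left₀ (Finset.expect_nonneg fun x _ => abs_nonneg _) h2 2
    have h4 := expect_sq_le_mul (u := fun x => exp (r / 2 * F x))
      (v := fun x => |halfDiff i F x|) fun x => abs_nonneg _
    simp only [exp_half_sq] at h4
    have h5 : 𝔼 x, |halfDiff i F x| ≤ 2 * a := by
      calc _ ≤ 𝔼 x, (p i x + p i (flipAt i x)) :=
            Finset.expect_le_expect fun x _ => hp.abs_halfDiff_le i x
        _ = 2 * 𝔼 x, p i x := by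
            rw [Finset.expect_add_distrib, expect_flipAt]
            ring
        _ ≤ 2 * a := by linarith [ha i]
    have h6 : 𝔼 x, exp (r * F x) * |halfDiff i F x| ≤ 3 * 𝔼 x, exp (r * F x) * p i x := by
      have h7 := hp.expect_exp_mul_flipAt_le hr i (hp.nonneg i)
      calc _ ≤ 𝔼 x, (exp (r * F x) * p i x + exp (r * F x) * p i (flipAt i x)) := by
            refine Finset.expect_le_expect fun x _ => ?_
            rw [← mul_add]
            exact mul_le_mul_of_nonneg_left (hp.abs_halfDiff_le i x) (exp_pos _).le
        _ ≤ _ := by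
            rw [Finset.expect_add_distrib]
            linarith
    have h8 : 0 ≤ 𝔼 x, exp (r * F x) * |halfDiff i F x| :=
      Finset.expect_nonneg fun x _ => by positivity
    rw [mul_pow, mul_pow, div_pow, sq_abs] at h3
    calc _ ≤ _ := h3
      _ ≤ r ^ 2 / 2 ^ 2 * 2 * (2 * a * (3 * 𝔼 x, exp (r * F x) * p i x)) := by
          gcongr
          · exact sq_exp_le_two hr
          · exact h4.trans (mul_le_mul h5 h6 h8 (by positivity))
      _ = _ := by ring
  calc _ ≤ ∑ i, 3 * r ^ 2 * a * 𝔼 x, exp (r * F x) * p i x := Finset.sum_le_sum fun i _ => h1 i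
    _ = 3 * r ^ 2 * a * 𝔼 x, exp (r * F x) * ∑ i, p i x := by
        rw [← Finset.mul_sum, ← Finset.expect_sum_comm]
        simp only [Finset.mul_sum]
    _ ≤ 3 * r ^ 2 * a * 𝔼 x, exp (r * F x) * S := by
        gcongr with x
        exact hS x
    _ = _ := by
        rw [← Finset.expect_mul]
        ring

/-- Gaussian concentration on the cube. -/
lemma gaussian_tail (hp : IsDecreaseBound F p β) {s V : ℝ} (hs : 0 < s) (hV0 : 0 < V)
    (hV : ∀ x, ∑ i, p i x ^ 2 ≤ V) (hβ : exp (2 * (s / (24 * V)) * β) ≤ 2) (hβ0 : 0 ≤ β) :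
    𝔼 x, (if s < |F x - 𝔼 y, F y| then (1 : ℝ) else 0) ≤ 2 * exp (-(s ^ 2 / (48 * V))) := by
  set Λ := s / (24 * V) with hΛ
  have hΛ0 : 0 < Λ := by positivity
  have hr : ∀ r, |r| ≤ Λ → exp (2 * |r| * β) ≤ 2 := fun r hr =>
    (exp_le_exp.2 (by gcongr)).trans hβ
  have h1 : ∀ r, |r| ≤ Λ → 𝔼 x, exp (r * F x) * (r * F x)
      - (𝔼 x, exp (r * F x)) * log (𝔼 x, exp (r * F x))
        ≤ 12 * V * r ^ 2 * 𝔼 x, exp (r * F x) := by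
    intro r h
    have h2 := cube_log_sobolev fun x => exp (r / 2 * F x)
    have h3 := hp.sum_expect_halfDiff_sq_le (hr r h) hV
    simp only [exp_half_sq, log_exp] at h2
    linarith
  have h2 : 12 * V * Λ ^ 2 - Λ * s = -(s ^ 2 / (48 * V)) := by
    rw [hΛ]
    field_simp
    ring
  refine (expect_indicator_lt_abs_le hΛ0.le s (B := exp (12 * V * Λ ^ 2)) ?_ ?_).trans_eq ?_
  · exact expect_exp_le_of_entropy_le hΛ0 (by positivity) fun r h0 h =>
      h1 r (by rwa [abs_of_pos h0])
  · have := expect_exp_le_of_entropy_le (F := fun x => -F x) (K := 12 * V) hΛ0 (by positivity)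
      fun r h0 h => by
        simpa only [mul_neg, neg_mul, neg_sq] using h1 (-r) (by rwa [abs_neg, abs_of_pos h0])
    simpa only [Finset.expect_neg_distrib, neg_sub_neg] using this
  · rw [mul_assoc, ← exp_add, ← h2]
    ring_nf

/-- Exponential concentration on the cube for functions whose increments are small in `L¹`. -/
lemma exponential_tail [Nonempty ι] (hp : IsDecreaseBound F p β) {s V a S R A l Λ : ℝ}
    (hV0 : 0 < V) (hV : ∀ x, ∑ i, p i x ^ 2 ≤ V) (ha : ∀ i, 𝔼 x, p i x ≤ a)
    (hS : ∀ x, ∑ i, p i x ≤ S) (hR : 0 < R) (hA : 0 ≤ A) (hRA : R * a * S ≤ A * V)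
    (hl : 0 < l) (hlR : l ≤ log R + 1) (hΛ0 : 0 < Λ)
    (hΛ : (12 + 3 * A) * V / l * Λ ^ 2 ≤ 1 / 2) (hβ : exp (2 * Λ * β) ≤ 2) (hβ0 : 0 ≤ β) :
    𝔼 x, (if s < |F x - 𝔼 y, F y| then (1 : ℝ) else 0) ≤ 2 * exp 2 * exp (-(Λ * s)) := by
  have hr : ∀ r, |r| ≤ Λ → exp (2 * |r| * β) ≤ 2 := fun r hr =>
    (exp_le_exp.2 (by gcongr)).trans hβ
  set K := (12 + 3 * A) * V / l with hK
  have hK0 : 0 ≤ K := by positivity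
  have h1 : ∀ r, |r| ≤ Λ → 𝔼 x, exp (r * F x) - (𝔼 x, exp (r / 2 * F x)) ^ 2
        ≤ K * r ^ 2 * 𝔼 x, exp (r * F x) := by
    intro r h
    have h2 := cube_variance_le hR fun x => exp (r / 2 * F x)
    have h3 := hp.sum_expect_halfDiff_sq_le (hr r h) hV
    have h4 := mul_le_mul_of_nonneg_left (hp.sum_expect_abs_halfDiff_sq_le (hr r h) ha hS) hR.le
    have hZ : 0 < 𝔼 x, exp (r * F x) := expect_exp_pos fun x => r * F x
    have h5 := mul_le_mul_of_nonneg_right hRA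
      (show 0 ≤ 3 * r ^ 2 * 𝔼 x, exp (r * F x) by positivity)
    simp only [exp_half_sq] at h2
    set D := 𝔼 x, exp (r * F x) - (𝔼 x, exp (r / 2 * F x)) ^ 2
    have hRHS : 0 ≤ (12 + 3 * A) * V * (r ^ 2 * 𝔼 x, exp (r * F x)) := by positivity
    have h6 : (log R + 1) * D ≤ (12 + 3 * A) * V * (r ^ 2 * 𝔼 x, exp (r * F x)) := by
      linarith
    have h7 : l * D ≤ (12 + 3 * A) * V * (r ^ 2 * 𝔼 x, exp (r * F x)) := by
      rcases le_total 0 D with hD | hD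
      · exact (mul_le_mul_of_nonneg_right hlR hD).trans h6
      · exact (mul_nonpos_of_nonneg_of_nonpos hl.le hD).trans hRHS
    rw [hK, mul_assoc, div_mul_eq_mul_div, le_div_iff₀ hl]
    linarith
  have h2 : exp (4 * K * Λ ^ 2) ≤ exp 2 := exp_le_exp.2 (by linarith)
  refine expect_indicator_lt_abs_le hΛ0.le s ?_ ?_
  · exact (expect_exp_le_of_variance_le hΛ0 hK0 hΛ fun r h0 h =>
      h1 r (by rwa [abs_of_pos h0])).trans h2
  · have := expect_exp_le_of_variance_le (F := fun x => -F x) hΛ0 hK0 hΛ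
      fun r h0 h => by
        simpa only [mul_neg, neg_mul, neg_sq, neg_div]
          using h1 (-r) (by rwa [abs_neg, abs_of_pos h0])
    simpa only [Finset.expect_neg_distrib, neg_sub_neg] using this.trans h2

end IsDecreaseBound

end CubeConcentration

/-! ### Unconditional norms -/

/-- `N` is a `1`-unconditional norm on `ℝⁿ`. -/
structure IsUnconditionalNorm {n : ℕ} (N : (Fin n → ℝ) → ℝ) : Prop where
  add_le : ∀ x y, N (x + y) ≤ N x + N y
  smul : ∀ (r : ℝ) (x), N (r • x) = |r| * N x
  eq_zero : ∀ x, N x = 0 → x = 0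
  sign : ∀ ε : Fin n → ℝ, (∀ i, ε i = 1 ∨ ε i = -1) → ∀ x : Fin n → ℝ,
    N (fun i => ε i * x i) = N x

lemma euclNorm_nonneg {n : ℕ} (x : Fin n → ℝ) : 0 ≤ euclNorm x := Real.sqrt_nonneg _

lemma euclNorm_sq {n : ℕ} (x : Fin n → ℝ) : euclNorm x ^ 2 = ∑ i, x i ^ 2 :=
  Real.sq_sqrt (Finset.sum_nonneg fun _ _ => sq_nonneg _)

lemma euclNorm_smul {n : ℕ} (r : ℝ) (x : Fin n → ℝ) : euclNorm (r • x) = |r| * euclNorm x := by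
  rw [← abs_of_nonneg (euclNorm_nonneg (r • x)), ← abs_of_nonneg (euclNorm_nonneg x), ← abs_mul]
  refine sq_eq_sq_iff_abs_eq_abs _ _ |>.1 ?_
  rw [mul_pow, euclNorm_sq, euclNorm_sq, Finset.mul_sum]
  simp [mul_pow]

lemma euclNorm_single {n : ℕ} (i : Fin n) : euclNorm (Pi.single i (1 : ℝ)) = 1 := by
  have h : ∀ j, (Pi.single i (1 : ℝ) : Fin n → ℝ) j ^ 2 = if j = i then 1 else 0 := by
    intro j
    by_cases h : j = i <;> simp [h]
  simp [euclNorm, h]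

lemma abs_le_euclNorm {n : ℕ} (x : Fin n → ℝ) (i : Fin n) : |x i| ≤ euclNorm x := by
  rw [euclNorm, ← Real.sqrt_sq_eq_abs]
  exact Real.sqrt_le_sqrt
    (Finset.single_le_sum (f := fun i => x i ^ 2) (fun j _ => sq_nonneg _) (Finset.mem_univ i))

lemma euclNorm_le_sum_abs {n : ℕ} (x : Fin n → ℝ) : euclNorm x ≤ ∑ i, |x i| := by
  refine abs_le_of_sq_le_sq' ?_ (Finset.sum_nonneg fun i _ => abs_nonneg _) |>.2
  rw [euclNorm_sq]
  calc ∑ i, x i ^ 2 = ∑ i, |x i| * |x i| := by simp [← sq]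
    _ ≤ ∑ i, |x i| * ∑ j, |x j| := Finset.sum_le_sum fun i _ =>
        mul_le_mul_of_nonneg_left (Finset.single_le_sum (f := fun j => |x j|)
          (fun j _ => abs_nonneg _) (Finset.mem_univ i)) (abs_nonneg _)
    _ = _ := by rw [← Finset.sum_mul, sq]

namespace IsUnconditionalNorm

variable {n : ℕ} {N : (Fin n → ℝ) → ℝ}

lemma zero (hN : IsUnconditionalNorm N) : N 0 = 0 := by
  simpa using hN.smul 0 0

lemma neg (hN : IsUnconditionalNorm N) (x : Fin n → ℝ) : N (-x) = N x := by
  simpa using hN.smul (-1) x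

lemma nonneg (hN : IsUnconditionalNorm N) (x : Fin n → ℝ) : 0 ≤ N x := by
  have h := hN.add_le x (-x)
  rw [add_neg_cancel, hN.zero, hN.neg] at h
  linarith

lemma sum_le (hN : IsUnconditionalNorm N) {ι : Type*} (s : Finset ι) (f : ι → Fin n → ℝ) :
    N (∑ i ∈ s, f i) ≤ ∑ i ∈ s, N (f i) :=
  Finset.le_sum_of_subadditive N hN.zero.le hN.add_le s f

lemma le_sum_single (hN : IsUnconditionalNorm N) (x : Fin n → ℝ) :
    N x ≤ ∑ i, |x i| * N (Pi.single i 1) := by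
  calc N x = N (∑ i, x i • Pi.single i (1 : ℝ)) := by
        congr 1
        ext j
        simp [Finset.sum_apply, Pi.single_apply]
    _ ≤ ∑ i, N (x i • Pi.single i (1 : ℝ)) := hN.sum_le _ _
    _ = _ := by simp_rw [hN.smul]

lemma bddAbove (hN : IsUnconditionalNorm N) :
    BddAbove {s | ∃ θ : Fin n → ℝ, euclNorm θ = 1 ∧ s = N θ} := by
  refine ⟨∑ i, N (Pi.single i 1), ?_⟩
  rintro s ⟨θ, hθ, rfl⟩
  refine (hN.le_sum_single θ).trans (Finset.sum_le_sum fun i _ => ?_)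
  have := abs_le_euclNorm θ i
  rw [hθ] at this
  exact mul_le_of_le_one_left (hN.nonneg _) this

lemma le_bConst_mul (hN : IsUnconditionalNorm N) (x : Fin n → ℝ) :
    N x ≤ bConst N * euclNorm x := by
  rcases (euclNorm_nonneg x).eq_or_lt with h | h
  · have hx : x = 0 := by
      ext i
      have := abs_le_euclNorm x i
      rw [← h] at this
      simpa using le_antisymm this (abs_nonneg _)
    simp [hx, hN.zero, euclNorm]
  · have h1 : N ((euclNorm x)⁻¹ • x) ≤ bConst N := by
      refine le_csSup hN.bddAbove ⟨_, ?_, rfl⟩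
      rw [euclNorm_smul, abs_of_pos (inv_pos.2 h), inv_mul_cancel₀ h.ne']
    rw [hN.smul, abs_of_pos (inv_pos.2 h), inv_mul_le_iff₀ h] at h1
    linarith

lemma bConst_pos (hN : IsUnconditionalNorm N) (hn : 1 ≤ n) : 0 < bConst N := by
  have h1 := hN.le_bConst_mul (Pi.single ⟨0, hn⟩ 1)
  rw [euclNorm_single, mul_one] at h1
  refine lt_of_lt_of_le ((hN.nonneg _).lt_of_ne' fun h => ?_) h1
  have := congrFun (hN.eq_zero _ h) ⟨0, hn⟩
  simp at this

lemma sub_le (hN : IsUnconditionalNorm N) (x y : Fin n → ℝ) : N x - N y ≤ N (x - y) := by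
  have := hN.add_le (x - y) y
  rw [sub_add_cancel] at this
  linarith

lemma abs_sub_le (hN : IsUnconditionalNorm N) (x y : Fin n → ℝ) : |N x - N y| ≤ N (x - y) := by
  refine abs_sub_le_iff.2 ⟨hN.sub_le x y, ?_⟩
  rw [← hN.neg (x - y), neg_sub]
  exact hN.sub_le y x

lemma bConst_nonneg (hN : IsUnconditionalNorm N) : 0 ≤ bConst N := by
  refine Real.sSup_nonneg ?_
  rintro s ⟨θ, -, rfl⟩
  exact hN.nonneg θ

lemma lipschitzWith (hN : IsUnconditionalNorm N) :
    LipschitzWith (Real.toNNReal (bConst N * n)) N := by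
  refine LipschitzWith.of_dist_le_mul fun x y => ?_
  rw [Real.dist_eq, Real.coe_toNNReal _ (mul_nonneg hN.bConst_nonneg (Nat.cast_nonneg n)),
    mul_assoc]
  refine (hN.abs_sub_le x y).trans ((hN.le_bConst_mul _).trans
    (mul_le_mul_of_nonneg_left ((euclNorm_le_sum_abs _).trans ?_) hN.bConst_nonneg))
  calc ∑ i, |(x - y) i| ≤ ∑ _i : Fin n, dist x y :=
        Finset.sum_le_sum fun i _ => dist_le_pi_dist x y i
    _ = n * dist x y := by simp

lemma continuous (hN : IsUnconditionalNorm N) : Continuous N := hN.lipschitzWith.continuous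

lemma update_neg (hN : IsUnconditionalNorm N) (x : Fin n → ℝ) (i : Fin n) (v : ℝ) :
    N (Function.update x i (-v)) = N (Function.update x i v) := by
  rw [← hN.sign (Function.update 1 i (-1)) _ (Function.update x i v)]
  · congr 1
    ext j
    rcases eq_or_ne j i with rfl | h <;> simp [*]
  · intro j
    rcases eq_or_ne j i with rfl | h <;> simp [*]

lemma update_convex (hN : IsUnconditionalNorm N) (x : Fin n → ℝ) (i : Fin n) {a b : ℝ} (ha : 0 ≤ a)
    (hb : 0 ≤ b) (hab : a + b = 1) (u v : ℝ) :
    N (Function.update x i (a * u + b * v)) ≤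
      a * N (Function.update x i u) + b * N (Function.update x i v) := by
  have h : Function.update x i (a * u + b * v) =
      a • Function.update x i u + b • Function.update x i v := by
    ext j
    rcases eq_or_ne j i with rfl | h
    · simp
    · simp [h, ← add_mul, hab]
  rw [h]
  refine (hN.add_le _ _).trans_eq ?_
  rw [hN.smul, hN.smul, abs_of_nonneg ha, abs_of_nonneg hb]

lemma update_mono (hN : IsUnconditionalNorm N) (x : Fin n → ℝ) (i : Fin n) {u v : ℝ}
    (h : |u| ≤ |v|) : N (Function.update x i u) ≤ N (Function.update x i v) := by
  rcases eq_or_ne v 0 with rfl | hv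
  · simp only [abs_zero, abs_nonpos_iff] at h
    rw [h]
  have h1 : |u / v| ≤ 1 := by
    rw [abs_div]
    exact div_le_one_of_le₀ h (abs_nonneg _)
  obtain ⟨h2, h3⟩ := abs_le.1 h1
  have := hN.update_convex x i (a := (1 + u / v) / 2) (b := (1 - u / v) / 2)
    (by linarith) (by linarith) (by ring) v (-v)
  rw [hN.update_neg, show (1 + u / v) / 2 * v + (1 - u / v) / 2 * -v = u by field_simp; ring] at this
  linarith

lemma exists_subgradient (hN : IsUnconditionalNorm N) (x : Fin n → ℝ) :
    ∃ w : Fin n → ℝ, ∑ i, w i * x i = N x ∧ ∀ y, ∑ i, w i * y i ≤ N y := by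
  obtain ⟨g, hg1, hg2⟩ : ∃ g : (Fin n → ℝ) →ₗ[ℝ] ℝ, g x = N x ∧ ∀ y, g y ≤ N y := by
    rcases eq_or_ne x 0 with rfl | hx
    · exact ⟨0, by simp [hN.zero], fun y => by simpa using hN.nonneg y⟩
    · obtain ⟨g, hg1, hg2⟩ := exists_extension_of_le_sublinear
        (LinearPMap.mkSpanSingleton (K := ℝ) x (N x) hx) N
        (fun c hc y => by rw [hN.smul, abs_of_pos hc]) hN.add_le (by
          rintro ⟨y, hy⟩
          obtain ⟨r, rfl⟩ := Submodule.mem_span_singleton.1 hy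
          rw [LinearPMap.mkSpanSingleton'_apply]
          rw [hN.smul, smul_eq_mul]
          exact mul_le_mul_of_nonneg_right (le_abs_self r) (hN.nonneg x))
      refine ⟨g, ?_, hg2⟩
      have := hg1 ⟨x, Submodule.mem_span_singleton_self x⟩
      rw [this]
      simpa using LinearPMap.mkSpanSingleton_apply ℝ ℝ (σ := RingHom.id ℝ) hx (N x)
  have h : ∀ y, ∑ i, g (fun j => if i = j then 1 else 0) * y i = g y := fun y => by
    simp_rw [LinearMap.pi_apply_eq_sum_univ g y, smul_eq_mul, mul_comm]
  exact ⟨_, (h x).trans hg1, fun y => (h y).trans_le (hg2 y)⟩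

/-- A subgradient of `N` at `x`. -/
noncomputable def subgradient (hN : IsUnconditionalNorm N) (x : Fin n → ℝ) : Fin n → ℝ :=
  (hN.exists_subgradient x).choose

lemma sum_subgradient_mul_self (hN : IsUnconditionalNorm N) (x : Fin n → ℝ) :
    ∑ i, hN.subgradient x i * x i = N x :=
  (hN.exists_subgradient x).choose_spec.1

lemma sum_subgradient_mul_le (hN : IsUnconditionalNorm N) (x y : Fin n → ℝ) :
    ∑ i, hN.subgradient x i * y i ≤ N y :=
  (hN.exists_subgradient x).choose_spec.2 y

lemma euclNorm_subgradient_le (hN : IsUnconditionalNorm N) (x : Fin n → ℝ) :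
    euclNorm (hN.subgradient x) ≤ bConst N := by
  have h1 := hN.sum_subgradient_mul_le x (hN.subgradient x)
  have h2 := hN.le_bConst_mul (hN.subgradient x)
  simp_rw [← sq] at h1
  rw [← euclNorm_sq] at h1
  rcases (euclNorm_nonneg (hN.subgradient x)).eq_or_lt with h | h
  · rw [← h]
    exact hN.bConst_nonneg
  · nlinarith

lemma sum_subgradient_sq_le (hN : IsUnconditionalNorm N) (x : Fin n → ℝ) :
    ∑ i, hN.subgradient x i ^ 2 ≤ bConst N ^ 2 := by
  rw [← euclNorm_sq]
  exact pow_le_pow_left₀ (euclNorm_nonneg _) (hN.euclNorm_subgradient_le x) 2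

lemma abs_subgradient_le (hN : IsUnconditionalNorm N) (x : Fin n → ℝ) (i : Fin n) :
    |hN.subgradient x i| ≤ bConst N :=
  (abs_le_euclNorm _ i).trans (hN.euclNorm_subgradient_le x)

lemma sum_abs_subgradient_le (hN : IsUnconditionalNorm N) (x : Fin n → ℝ) :
    ∑ i, |hN.subgradient x i| ≤ √n * bConst N := by
  refine abs_le_of_sq_le_sq' ?_ (mul_nonneg (Real.sqrt_nonneg _) hN.bConst_nonneg) |>.2
  rw [mul_pow, Real.sq_sqrt (Nat.cast_nonneg n)]
  refine (sq_sum_le_card_mul_sum_sq).trans ?_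
  simp only [sq_abs, Finset.card_univ, Fintype.card_fin]
  exact mul_le_mul_of_nonneg_left (hN.sum_subgradient_sq_le x) (Nat.cast_nonneg n)

lemma sub_update_add_le (hN : IsUnconditionalNorm N) (x : Fin n → ℝ) (i : Fin n) (r : ℝ) :
    N x - N (Function.update x i (x i + r)) ≤ -(hN.subgradient x i * r) := by
  have h1 := hN.sum_subgradient_mul_self x
  have h2 := hN.sum_subgradient_mul_le x (Function.update x i (x i + r))
  have h3 : ∑ j, hN.subgradient x j * Function.update x i (x i + r) j =
      ∑ j, hN.subgradient x j * x j + hN.subgradient x i * r := by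
    have : ∀ j, hN.subgradient x j * Function.update x i (x i + r) j =
        hN.subgradient x j * x j + if j = i then hN.subgradient x i * r else 0 := by
      intro j
      rcases eq_or_ne j i with rfl | h
      · simp [mul_add]
      · simp [h]
    simp [this, Finset.sum_add_distrib]
  linarith

lemma sub_update_le (hN : IsUnconditionalNorm N) (x : Fin n → ℝ) (i : Fin n) (v : ℝ) :
    N x - N (Function.update x i v) ≤ |hN.subgradient x i| * |v - x i| := by
  have := hN.sub_update_add_le x i (v - x i)
  rw [add_sub_cancel] at this
  rw [← abs_mul]
  exact this.trans (neg_le_abs _)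

lemma abs_sub_update_le (hN : IsUnconditionalNorm N) (x : Fin n → ℝ) (i : Fin n) (v : ℝ) :
    |N x - N (Function.update x i v)| ≤ bConst N * |v - x i| := by
  have key : ∀ (x : Fin n → ℝ) (v : ℝ), N x - N (Function.update x i v) ≤ bConst N * |v - x i| :=
    fun x v => (hN.sub_update_le x i v).trans
      (mul_le_mul_of_nonneg_right (hN.abs_subgradient_le x i) (abs_nonneg _))
  refine abs_sub_le_iff.2 ⟨key x v, ?_⟩
  have := key (Function.update x i v) (x i)
  rw [Function.update_idem, Function.update_eq_self, Function.update_self, abs_sub_comm] at this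
  exact this

end IsUnconditionalNorm

/-- The larger of the increments of `N` at `x` when the coordinate `i` is moved by `±η`. -/
noncomputable def maxIncrement {n : ℕ} (N : (Fin n → ℝ) → ℝ) (i : Fin n) (η : ℝ)
    (x : Fin n → ℝ) : ℝ :=
  max (N (Function.update x i (x i + η))) (N (Function.update x i (x i - η))) - N x

namespace IsUnconditionalNorm

variable {n : ℕ} {N : (Fin n → ℝ) → ℝ}

lemma mul_abs_subgradient_le (hN : IsUnconditionalNorm N) (i : Fin n) {η : ℝ}
    (x : Fin n → ℝ) : η * |hN.subgradient x i| ≤ maxIncrement N i η x := by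
  have h1 := hN.sub_update_add_le x i η
  have h2 := hN.sub_update_add_le x i (-η)
  rw [← sub_eq_add_neg] at h2
  unfold maxIncrement
  have h3 := le_max_left (N (Function.update x i (x i + η))) (N (Function.update x i (x i - η)))
  have h4 := le_max_right (N (Function.update x i (x i + η))) (N (Function.update x i (x i - η)))
  rcases abs_cases (hN.subgradient x i) with ⟨h, -⟩ | ⟨h, -⟩ <;> rw [h] <;> linarith

lemma maxIncrement_le (hN : IsUnconditionalNorm N) (i : Fin n) {η : ℝ} (hη : 0 ≤ η)
    (x : Fin n → ℝ) : maxIncrement N i η x ≤ bConst N * η := by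
  have h1 := (abs_le.1 (hN.abs_sub_update_le x i (x i + η))).1
  have h2 := (abs_le.1 (hN.abs_sub_update_le x i (x i - η))).1
  simp only [add_sub_cancel_left, abs_of_nonneg hη, sub_sub_cancel_left, abs_neg] at h1 h2
  unfold maxIncrement
  rw [sub_le_iff_le_add, max_le_iff]
  constructor <;> linarith

lemma maxIncrement_nonneg (hN : IsUnconditionalNorm N) (i : Fin n) {η : ℝ} (hη : 0 ≤ η)
    (x : Fin n → ℝ) : 0 ≤ maxIncrement N i η x :=
  (mul_nonneg hη (abs_nonneg _)).trans (hN.mul_abs_subgradient_le i x)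

lemma continuous_maxIncrement (hN : IsUnconditionalNorm N) (i : Fin n) (η : ℝ) :
    Continuous (maxIncrement N i η) := by
  have := hN.continuous
  unfold maxIncrement
  fun_prop

end IsUnconditionalNorm

/-! ### Integration of an unconditional norm against the Gaussian measure -/

section Gaussian

variable {n : ℕ}

instance : IsProbabilityMeasure (_root_.stdGaussian n) := by
  unfold _root_.stdGaussian
  infer_instance

lemma integrable_abs_gaussianReal : Integrable (fun x : ℝ => |x|) (gaussianReal 0 1) :=
  ((memLp_id_gaussianReal 1).integrable le_rfl).abs

lemma integrable_sq_gaussianReal : Integrable (fun x : ℝ => x ^ 2) (gaussianReal 0 1) :=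
  (memLp_id_gaussianReal 2).integrable_sq

lemma integral_sq_gaussianReal : ∫ x, x ^ 2 ∂gaussianReal 0 1 = 1 := by
  have h := variance_id_gaussianReal (μ := 0) (v := 1)
  rw [variance_eq_sub (memLp_id_gaussianReal 2)] at h
  simpa using h

lemma integrable_eval_abs (i : Fin n) : Integrable (fun x => |x i|) (_root_.stdGaussian n) :=
  integrable_comp_eval (i := i) (μ := fun _ : Fin n => gaussianReal 0 1) integrable_abs_gaussianReal

lemma integrable_eval_sq (i : Fin n) : Integrable (fun x => x i ^ 2) (_root_.stdGaussian n) :=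
  integrable_comp_eval (i := i) (μ := fun _ : Fin n => gaussianReal 0 1) integrable_sq_gaussianReal

lemma integral_eval_sq (i : Fin n) : ∫ x, x i ^ 2 ∂_root_.stdGaussian n = 1 := by
  rw [← integral_sq_gaussianReal]
  exact integral_comp_eval (i := i) (μ := fun _ : Fin n => gaussianReal 0 1)
    (f := fun x : ℝ => x ^ 2) integrable_sq_gaussianReal.aestronglyMeasurable

lemma integrable_euclNorm_sq :
    Integrable (fun x => euclNorm x ^ 2) (_root_.stdGaussian n) := by
  simp_rw [euclNorm_sq]
  exact integrable_finsetSum _ fun i _ => integrable_eval_sq i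

lemma integral_euclNorm_sq : ∫ x, euclNorm x ^ 2 ∂_root_.stdGaussian n = n := by
  simp_rw [euclNorm_sq]
  rw [integral_finsetSum _ fun i _ => integrable_eval_sq i]
  simp [integral_eval_sq]

lemma measurePreserving_update (i : Fin n) :
    MeasurePreserving (fun p : (Fin n → ℝ) × ℝ => Function.update p.1 i p.2)
      ((_root_.stdGaussian n).prod (gaussianReal 0 1)) (_root_.stdGaussian n) := by
  have hm : Measurable (fun p : (Fin n → ℝ) × ℝ => Function.update p.1 i p.2) := by
    have : Continuous (fun p : (Fin n → ℝ) × ℝ => Function.update p.1 i p.2) := by fun_prop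
    exact this.measurable
  refine ⟨hm, (Measure.pi_eq fun s hs => ?_).symm⟩
  rw [Measure.map_apply hm (MeasurableSet.univ_pi hs)]
  have h : (fun p : (Fin n → ℝ) × ℝ => Function.update p.1 i p.2) ⁻¹' Set.univ.pi s =
      (Set.univ.pi (Function.update s i Set.univ)) ×ˢ (s i) := by
    ext ⟨x, v⟩
    simp only [Set.mem_preimage, Set.mem_univ_pi, Set.mem_prod]
    constructor
    · refine fun h => ⟨fun j => ?_, by simpa using h i⟩
      rcases eq_or_ne j i with rfl | hj
      · simp
      · simpa [hj] using h j
    · rintro ⟨h, hv⟩ j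
      rcases eq_or_ne j i with rfl | hj
      · simpa using hv
      · simpa [hj] using h j
  rw [h, Measure.prod_prod, _root_.stdGaussian, Measure.pi_pi]
  have h2 : ∀ j, gaussianReal 0 1 (Function.update s i Set.univ j) =
      Function.update (fun j => gaussianReal 0 1 (s j)) i 1 j := by
    intro j
    rcases eq_or_ne j i with rfl | hj <;> simp [*]
  simp_rw [h2]
  rw [Finset.prod_update_of_mem (Finset.mem_univ i), one_mul, mul_comm,
    ← Finset.prod_sdiff (Finset.subset_univ {i}), Finset.prod_singleton, mul_comm]

lemma integrable_comp_update (i : Fin n) {f : (Fin n → ℝ) → ℝ}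
    (hf : Integrable f (_root_.stdGaussian n)) :
    Integrable (fun p : (Fin n → ℝ) × ℝ => f (Function.update p.1 i p.2))
      ((_root_.stdGaussian n).prod (gaussianReal 0 1)) :=
  (measurePreserving_update i).integrable_comp_of_integrable hf

lemma integral_eq_integral_update (i : Fin n) {f : (Fin n → ℝ) → ℝ}
    (hf : Integrable f (_root_.stdGaussian n)) :
    ∫ x, f x ∂_root_.stdGaussian n =
      ∫ x, ∫ v, f (Function.update x i v) ∂gaussianReal 0 1 ∂_root_.stdGaussian n := by
  have h := measurePreserving_update i
  rw [← integral_prod _ (integrable_comp_update i hf)]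
  conv_lhs => rw [← h.map_eq]
  refine integral_map h.measurable.aemeasurable ?_
  rw [h.map_eq]
  exact hf.aestronglyMeasurable

/-- The Gaussian measure of the complement of the unit interval. -/
noncomputable def gaussianTailMass : ℝ := (gaussianReal 0 1).real {v | 1 ≤ |v|}

lemma gaussianTailMass_pos : 0 < gaussianTailMass := by
  refine ENNReal.toReal_pos (fun h => ?_) (measure_ne_top _ _)
  have h2 : volume {v : ℝ | 1 ≤ |v|} = 0 :=
    gaussianReal_absolutelyContinuous' 0 one_ne_zero h
  have h3 : volume (Set.Icc (1 : ℝ) 2) ≤ volume {v : ℝ | 1 ≤ |v|} :=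
    measure_mono fun v hv => hv.1.trans (le_abs_self v)
  rw [h2, Real.volume_Icc] at h3
  norm_num at h3

end Gaussian

namespace IsUnconditionalNorm

variable {n : ℕ} {N : (Fin n → ℝ) → ℝ}

lemma integrable_comp (hN : IsUnconditionalNorm N) {f : (Fin n → ℝ) → Fin n → ℝ}
    (hf : Continuous f) {C : ℝ} (h : ∀ x j, |f x j| ≤ C * |x j|) :
    Integrable (fun x => N (f x)) (_root_.stdGaussian n) := by
  have h1 : Integrable (fun x : Fin n → ℝ => bConst N * (∑ j, C * |x j|))
      (_root_.stdGaussian n) :=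
    (integrable_finsetSum _ fun i _ => (integrable_eval_abs i).const_mul C).const_mul _
  refine h1.mono' (hN.continuous.comp hf).aestronglyMeasurable (ae_of_all _ fun x => ?_)
  rw [Real.norm_of_nonneg (hN.nonneg _)]
  exact (hN.le_bConst_mul _).trans (mul_le_mul_of_nonneg_left
    ((euclNorm_le_sum_abs _).trans (Finset.sum_le_sum fun j _ => h x j)) hN.bConst_nonneg)

lemma integrable (hN : IsUnconditionalNorm N) : Integrable N (_root_.stdGaussian n) :=
  hN.integrable_comp continuous_id (C := 1) fun x j => by simp

lemma integrable_update_mul (hN : IsUnconditionalNorm N) (i : Fin n) (β : ℝ) :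
    Integrable (fun x => N (Function.update x i (β * x i))) (_root_.stdGaussian n) := by
  refine hN.integrable_comp (C := 1 + |β|) (by fun_prop) fun x j => ?_
  rcases eq_or_ne j i with rfl | h
  · rw [Function.update_self, abs_mul]
    nlinarith [abs_nonneg (x j)]
  · rw [Function.update_of_ne h]
    nlinarith [abs_nonneg (x j), mul_nonneg (abs_nonneg β) (abs_nonneg (x j))]

lemma integral_pos (hN : IsUnconditionalNorm N) (hn : 1 ≤ n) :
    0 < ∫ x, N x ∂_root_.stdGaussian n := by
  rw [integral_pos_iff_support_of_nonneg hN.nonneg hN.integrable]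
  have : Nonempty (Fin n) := ⟨⟨0, hn⟩⟩
  have : NullSingletonClass (_root_.stdGaussian n) := by
    have : NullSingletonClass (gaussianReal 0 1) := nullSingletonClass_gaussianReal one_ne_zero
    unfold _root_.stdGaussian
    infer_instance
  have h : ({0}ᶜ : Set (Fin n → ℝ)) ⊆ Function.support N := fun x hx h0 => hx (hN.eq_zero x h0)
  refine lt_of_lt_of_le ?_ (measure_mono h)
  rw [prob_compl_eq_one_sub (measurableSet_singleton 0), measure_singleton]
  simp

lemma integral_le (hN : IsUnconditionalNorm N) (hn : 1 ≤ n) :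
    ∫ x, N x ∂_root_.stdGaussian n ≤ bConst N * √n := by
  have hn' : 0 < √(n : ℝ) := Real.sqrt_pos.2 (by exact_mod_cast hn)
  have h : ∀ x, N x ≤ bConst N * ((euclNorm x ^ 2 / √n + √n) / 2) := fun x => by
    refine (hN.le_bConst_mul x).trans (mul_le_mul_of_nonneg_left ?_ hN.bConst_nonneg)
    rw [le_div_iff₀ two_pos, ← sub_nonneg]
    have : euclNorm x ^ 2 / √n + √n - euclNorm x * 2 = (euclNorm x - √n) ^ 2 / √n := by
      field_simp
      ring
    rw [this]
    positivity
  have hi := integrable_euclNorm_sq (n := n)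
  refine (integral_mono hN.integrable (by fun_prop) h).trans_eq ?_
  rw [integral_const_mul, integral_div, integral_add (by fun_prop) (by fun_prop), integral_div,
    integral_euclNorm_sq]
  simp

lemma rpow_mul_integral_le (hN : IsUnconditionalNorm N) (hM : MinimalMPosition n N) (i : Fin n)
    {β : ℝ} (hβ : 0 < β) :
    β ^ ((1 : ℝ) / n) * ∫ x, N x ∂_root_.stdGaussian n ≤
      ∫ x, N (Function.update x i (β * x i)) ∂_root_.stdGaussian n := by
  have hn : (n : ℝ) ≠ 0 := by
    have := i.pos
    positivity
  set s : ℝ := β ^ (-((1 : ℝ) / n)) with hs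
  have hs0 : 0 < s := Real.rpow_pos_of_pos hβ _
  have hsn : s ^ n = β⁻¹ := by
    rw [hs, ← Real.rpow_natCast, ← Real.rpow_mul hβ.le]
    simp [hn, Real.rpow_neg_one]
  have hsβ : β ^ ((1 : ℝ) / n) = s⁻¹ := by rw [hs, Real.rpow_neg hβ.le, inv_inv]
  let d : Fin n → ℝ := fun j => Function.update (1 : Fin n → ℝ) i β j * s
  have hd : ∏ j, d j = 1 := by
    rw [Finset.prod_mul_distrib, Finset.prod_update_of_mem (Finset.mem_univ i)]
    simp [hsn, hβ.ne']
  have h := hM (Matrix.toLin' (Matrix.diagonal d)) (by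
    rw [LinearMap.det_toLin', Matrix.det_diagonal, hd])
  have hT : ∀ x, N (Matrix.toLin' (Matrix.diagonal d) x) =
      s * N (Function.update x i (β * x i)) := fun x => by
    rw [← abs_of_pos hs0, ← hN.smul]
    congr 1
    ext j
    rw [Matrix.toLin'_apply, Matrix.mulVec_diagonal]
    rcases eq_or_ne j i with rfl | hj
    · simp [d]
      ring
    · simp [d, hj]
  simp_rw [hT] at h
  rw [integral_const_mul] at h
  rw [hsβ, inv_mul_le_iff₀ hs0]
  exact h

end IsUnconditionalNorm

/-! ### The influence of a coordinate in the position of minimal `M` -/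

section Influence

open Filter Topology

/-- The second difference quotient of a function differentiable at `v` tends to zero. -/
lemma tendsto_second_difference {f : ℝ → ℝ} {v : ℝ} (hf : DifferentiableAt ℝ f v) :
    Tendsto (fun η : ℝ => η⁻¹ * (f ((1 + η) * v) + f ((1 - η) * v) - 2 * f v)) (𝓝[≠] 0) (𝓝 0) := by
  have h1 : HasDerivAt (fun η : ℝ => f ((1 + η) * v)) (deriv f v * v) 0 := by
    have : HasDerivAt (fun η : ℝ => (1 + η) * v) v 0 := by
      simpa using ((hasDerivAt_id (0 : ℝ)).const_add 1).mul_const v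
    refine HasDerivAt.comp (h₂ := f) 0 ?_ this
    simpa using hf.hasDerivAt
  have h2 : HasDerivAt (fun η : ℝ => f ((1 - η) * v)) (deriv f v * -v) 0 := by
    have : HasDerivAt (fun η : ℝ => (1 - η) * v) (-v) 0 := by
      simpa using ((hasDerivAt_id (0 : ℝ)).const_sub 1).mul_const v
    refine HasDerivAt.comp (h₂ := f) 0 ?_ this
    simpa using hf.hasDerivAt
  have h := (h1.add h2).tendsto_slope_zero
  simp only [mul_neg, add_neg_cancel, zero_add, add_zero, sub_zero, one_mul, Pi.add_apply] at h
  refine h.congr fun η => ?_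
  rw [smul_eq_mul, two_mul]

namespace IsUnconditionalNorm

variable {n : ℕ} {N : (Fin n → ℝ) → ℝ}

lemma differentiableAt_ae (hN : IsUnconditionalNorm N) (x : Fin n → ℝ) (i : Fin n) :
    ∀ᵐ v ∂gaussianReal 0 1, DifferentiableAt ℝ (fun u => N (Function.update x i u)) v := by
  have hL : LipschitzWith (Real.toNNReal (bConst N)) (fun u => N (Function.update x i u)) := by
    refine LipschitzWith.of_dist_le_mul fun u v => ?_
    rw [Real.dist_eq, Real.coe_toNNReal _ hN.bConst_nonneg]
    have := hN.abs_sub_update_le (Function.update x i u) i v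
    rwa [Function.update_idem, Function.update_self, ← Real.dist_eq, ← Real.dist_eq,
      dist_comm v u] at this
  exact (gaussianReal_absolutelyContinuous 0 one_ne_zero).ae_le hL.ae_differentiableAt_real

/-- The second difference of `N` at `x` under scalings of the coordinate `i`. -/
noncomputable def secondDiff (N : (Fin n → ℝ) → ℝ) (i : Fin n) (η : ℝ) (x : Fin n → ℝ) : ℝ :=
  N (Function.update x i ((1 + η) * x i)) + N (Function.update x i ((1 - η) * x i)) - 2 * N x

lemma integrable_secondDiff (hN : IsUnconditionalNorm N) (i : Fin n) (η : ℝ) :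
    Integrable (secondDiff N i η) (_root_.stdGaussian n) :=
  ((hN.integrable_update_mul i (1 + η)).add (hN.integrable_update_mul i (1 - η))).sub
    (hN.integrable.const_mul 2)

lemma continuous_secondDiff (hN : IsUnconditionalNorm N) (i : Fin n) (η : ℝ) :
    Continuous (secondDiff N i η) := by
  have := hN.continuous
  unfold secondDiff
  fun_prop

lemma abs_secondDiff_le (hN : IsUnconditionalNorm N) (i : Fin n) (η : ℝ) (x : Fin n → ℝ) :
    |η⁻¹ * secondDiff N i η x| ≤ 2 * bConst N * |x i| := by
  rcases eq_or_ne η 0 with rfl | hη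
  · simp only [inv_zero, zero_mul, abs_zero]
    have := hN.bConst_nonneg
    positivity
  have h1 := hN.abs_sub_update_le x i ((1 + η) * x i)
  have h2 := hN.abs_sub_update_le x i ((1 - η) * x i)
  rw [show (1 + η) * x i - x i = η * x i by ring, abs_mul, abs_sub_comm] at h1
  rw [show (1 - η) * x i - x i = -(η * x i) by ring, abs_neg, abs_mul, abs_sub_comm] at h2
  rw [abs_mul, abs_inv, inv_mul_le_iff₀ (abs_pos.2 hη)]
  have h3 : secondDiff N i η x = (N (Function.update x i ((1 + η) * x i)) - N x) +
    (N (Function.update x i ((1 - η) * x i)) - N x) := by unfold secondDiff; ring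
  rw [h3]
  refine (abs_add_le _ _).trans ?_
  linarith

lemma tendsto_integral_secondDiff (hN : IsUnconditionalNorm N) (i : Fin n) :
    Tendsto (fun η : ℝ => η⁻¹ * ∫ x, secondDiff N i η x ∂_root_.stdGaussian n)
      (𝓝[≠] 0) (𝓝 0) := by
  have hb := hN.bConst_nonneg
  have habs := integrable_abs_gaussianReal
  have hcont : ∀ η, Continuous fun p : (Fin n → ℝ) × ℝ =>
      secondDiff N i η (Function.update p.1 i p.2) := fun η =>
    (hN.continuous_secondDiff i η).comp (by fun_prop)
  have hbd : ∀ (η : ℝ) (x : Fin n → ℝ) (v : ℝ),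
      ‖η⁻¹ * secondDiff N i η (Function.update x i v)‖ ≤ 2 * bConst N * |v| := fun η x v => by
    simpa using hN.abs_secondDiff_le i η (Function.update x i v)
  have inner : ∀ x : Fin n → ℝ, Tendsto (fun η : ℝ =>
      ∫ v, η⁻¹ * secondDiff N i η (Function.update x i v) ∂gaussianReal 0 1)
      (𝓝[≠] 0) (𝓝 (∫ _, 0 ∂gaussianReal 0 1)) := fun x => by
    refine tendsto_integral_filter_of_dominated_convergence (fun v => 2 * bConst N * |v|)
      (Eventually.of_forall fun η => ?_) (Eventually.of_forall fun η => ae_of_all _ (hbd η x))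
      (habs.const_mul _) ?_
    · exact (((hcont η).comp (Continuous.prodMk_right x)).const_mul _).aestronglyMeasurable
    · filter_upwards [hN.differentiableAt_ae x i] with v hv
      simpa [secondDiff] using tendsto_second_difference hv
  have outer : Tendsto (fun η : ℝ => ∫ x, ∫ v, η⁻¹ * secondDiff N i η (Function.update x i v)
      ∂gaussianReal 0 1 ∂_root_.stdGaussian n) (𝓝[≠] 0)
      (𝓝 (∫ _, (∫ _, 0 ∂gaussianReal 0 1) ∂_root_.stdGaussian n)) := by
    refine tendsto_integral_filter_of_dominated_convergence
      (fun _ => ∫ v, 2 * bConst N * |v| ∂gaussianReal 0 1)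
      (Eventually.of_forall fun η => ?_) (Eventually.of_forall fun η => ae_of_all _ fun x => ?_)
      (integrable_const _) (ae_of_all _ inner)
    · exact (((hcont η).const_mul _).stronglyMeasurable.integral_prod_right').aestronglyMeasurable
    · exact norm_integral_le_of_norm_le (habs.const_mul _) (ae_of_all _ (hbd η x))
  simp only [integral_zero] at outer
  refine outer.congr fun η => ?_
  rw [integral_eq_integral_update i (hN.integrable_secondDiff i η), ← integral_const_mul]
  simp_rw [integral_const_mul]

/-- The increment of `N` at `x` when the coordinate `i` is multiplied by `1 + η`. -/
noncomputable def dilationIncrement (N : (Fin n → ℝ) → ℝ) (i : Fin n) (η : ℝ) (x : Fin n → ℝ) : ℝ :=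
  N (Function.update x i ((1 + η) * x i)) - N x

lemma integrable_dilationIncrement (hN : IsUnconditionalNorm N) (i : Fin n) (η : ℝ) :
    Integrable (dilationIncrement N i η) (_root_.stdGaussian n) :=
  (hN.integrable_update_mul i (1 + η)).sub hN.integrable

lemma one_sub_le_rpow {η : ℝ} (hη : 0 < η) (hη2 : η ≤ 1 / 2) (n : ℕ) :
    1 - 2 * η / n ≤ (1 - η) ^ ((1 : ℝ) / n) := by
  have h1 : 0 < 1 - η := by linarith
  have h2 : -(2 * η) ≤ log (1 - η) := by
    refine le_trans ?_ (Real.one_sub_inv_le_log_of_pos h1)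
    rw [← sub_nonneg]
    have : 1 - (1 - η)⁻¹ - -(2 * η) = η * (1 - 2 * η) / (1 - η) := by field_simp; ring
    rw [this]
    exact div_nonneg (mul_nonneg hη.le (by linarith)) h1.le
  rw [Real.rpow_def_of_pos h1]
  refine le_trans ?_ (Real.add_one_le_exp _)
  have : -(2 * η) * (1 / n) ≤ log (1 - η) * (1 / n) :=
    mul_le_mul_of_nonneg_right h2 (by positivity)
  calc 1 - 2 * η / n = -(2 * η) * (1 / n) + 1 := by ring
    _ ≤ _ := by linarith

lemma exists_integral_dilationIncrement_le (hN : IsUnconditionalNorm N)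
    (hM : MinimalMPosition n N) (i : Fin n) :
    ∃ η : ℝ, 0 < η ∧ ∫ x, dilationIncrement N i η x ∂_root_.stdGaussian n ≤
      3 * η * ((∫ x, N x ∂_root_.stdGaussian n) / n) := by
  have hn : (0 : ℝ) < n := by exact_mod_cast i.pos
  have hE := hN.integral_pos i.pos
  set E := ∫ x, N x ∂_root_.stdGaussian n with hEdef
  have h1 : ∀ᶠ η : ℝ in 𝓝[>] 0, η⁻¹ * ∫ x, secondDiff N i η x ∂_root_.stdGaussian n < E / n :=
    ((hN.tendsto_integral_secondDiff i).mono_left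
      (nhdsWithin_mono _ fun x (hx : 0 < x) => hx.ne')).eventually_lt_const (by positivity)
  have h2 : ∀ᶠ η : ℝ in 𝓝[>] 0, η ∈ Set.Ioo (0 : ℝ) (1 / 2) :=
    Ioo_mem_nhdsGT (by norm_num)
  obtain ⟨η, h3, hη0, hη2⟩ := (h1.and h2).exists
  refine ⟨η, hη0, ?_⟩
  rw [inv_mul_lt_iff₀ hη0] at h3
  have h4 := hN.rpow_mul_integral_le hM i (β := 1 - η) (by linarith)
  have h5 := mul_le_mul_of_nonneg_right (one_sub_le_rpow hη0 hη2.le n) hE.le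
  have h6 : ∫ x, secondDiff N i η x ∂_root_.stdGaussian n =
      ∫ x, dilationIncrement N i η x ∂_root_.stdGaussian n +
        (∫ x, N (Function.update x i ((1 - η) * x i)) ∂_root_.stdGaussian n - E) := by
    have hI : Integrable (fun x => N (Function.update x i ((1 - η) * x i)) - N x)
      (_root_.stdGaussian n) := (hN.integrable_update_mul i _).sub hN.integrable
    rw [hEdef, ← integral_sub (hN.integrable_update_mul i _) hN.integrable, ← integral_add
      (hN.integrable_dilationIncrement i η) hI]
    refine integral_congr_ae (ae_of_all _ fun x => ?_)
    simp only [secondDiff, dilationIncrement]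
    ring
  have h7 : (1 - 2 * η / n) * E = E - 2 * η * (E / n) := by ring
  linarith

lemma update_increment_mono (hN : IsUnconditionalNorm N) (x : Fin n → ℝ) (i : Fin n)
    {u v η : ℝ} (huv : u ≤ v) (hη : 0 < η) :
    N (Function.update x i (u + η)) - N (Function.update x i u) ≤
      N (Function.update x i (v + η)) - N (Function.update x i v) := by
  have hD : 0 < v + η - u := by linarith
  have h1 := hN.update_convex x i (a := (v - u) / (v + η - u)) (b := η / (v + η - u))
    (div_nonneg (by linarith) hD.le) (by positivity) (by field_simp; ring) u (v + η)
  have h2 := hN.update_convex x i (a := η / (v + η - u)) (b := (v - u) / (v + η - u))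
    (by positivity) (div_nonneg (by linarith) hD.le) (by field_simp; ring) u (v + η)
  rw [show (v - u) / (v + η - u) * u + η / (v + η - u) * (v + η) = u + η by
    field_simp; ring] at h1
  rw [show η / (v + η - u) * u + (v - u) / (v + η - u) * (v + η) = v by
    field_simp; ring] at h2
  have h3 : (v - u) / (v + η - u) + η / (v + η - u) = 1 := by field_simp; ring
  have h4 : (v - u) / (v + η - u) = 1 - η / (v + η - u) := by linarith
  rw [h4] at h1 h2
  linarith

lemma maxIncrement_le_dilationIncrement (hN : IsUnconditionalNorm N) (x : Fin n → ℝ) (i : Fin n)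
    {v η : ℝ} (hη : 0 < η) (hv1 : 1 ≤ |v|) (hv : |x i| ≤ |v|) :
    maxIncrement N i η x ≤ dilationIncrement N i η (Function.update x i v) := by
  have habs : ∀ u, N (Function.update x i |u|) = N (Function.update x i u) := fun u => by
    rcases abs_cases u with ⟨h, -⟩ | ⟨h, -⟩ <;> rw [h]
    exact hN.update_neg x i u
  have h1 : maxIncrement N i η x ≤
      N (Function.update x i (|x i| + η)) - N (Function.update x i |x i|) := by
    rw [habs (x i), Function.update_eq_self]
    refine sub_le_sub_right (max_le ?_ ?_) _ <;> apply hN.update_mono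
    · refine (abs_add_le _ _).trans ?_
      rw [abs_of_pos hη]
      exact le_abs_self _
    · refine (abs_sub _ _).trans ?_
      rw [abs_of_pos hη]
      exact le_abs_self _
  have h2 := hN.update_increment_mono x i hv hη
  have h3 : N (Function.update x i (|v| + η)) ≤ N (Function.update x i ((1 + η) * v)) := by
    apply hN.update_mono
    rw [abs_of_nonneg (by positivity), abs_mul, abs_of_pos (by positivity : 0 < 1 + η)]
    nlinarith
  rw [habs v] at h2
  simp only [dilationIncrement, Function.update_idem, Function.update_self]
  linarith

lemma dilationIncrement_nonneg (hN : IsUnconditionalNorm N) (i : Fin n) {η : ℝ} (hη : 0 < η)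
    (x : Fin n → ℝ) : 0 ≤ dilationIncrement N i η x := by
  have := hN.update_mono x i (u := x i) (v := (1 + η) * x i) (by
    rw [abs_mul, abs_of_pos (by positivity : 0 < 1 + η)]
    nlinarith [abs_nonneg (x i)])
  rw [Function.update_eq_self] at this
  exact sub_nonneg.2 this

lemma maxIncrement_le_add_integral (hN : IsUnconditionalNorm N) (i : Fin n) {η : ℝ}
    (hη : 0 < η) (x : Fin n → ℝ)
    (hx : Integrable (fun v => dilationIncrement N i η (Function.update x i v))
      (gaussianReal 0 1)) :
    maxIncrement N i η x ≤ dilationIncrement N i η x + gaussianTailMass⁻¹ *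
      ∫ v, dilationIncrement N i η (Function.update x i v) ∂gaussianReal 0 1 := by
  have hp := gaussianTailMass_pos
  have h0 : 0 ≤ ∫ v, dilationIncrement N i η (Function.update x i v) ∂gaussianReal 0 1 :=
    integral_nonneg fun v => hN.dilationIncrement_nonneg i hη _
  by_cases h : 1 ≤ |x i|
  · have := hN.maxIncrement_le_dilationIncrement x i hη h le_rfl
    rw [Function.update_eq_self] at this
    have : 0 ≤ gaussianTailMass⁻¹ *
      ∫ v, dilationIncrement N i η (Function.update x i v) ∂gaussianReal 0 1 := by positivity
    linarith
  · have hm : MeasurableSet {v : ℝ | 1 ≤ |v|} := measurableSet_le measurable_const (by fun_prop)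
    have h1 : maxIncrement N i η x * gaussianTailMass ≤
        ∫ v, dilationIncrement N i η (Function.update x i v) ∂gaussianReal 0 1 := by
      calc maxIncrement N i η x * gaussianTailMass
          = ∫ v, {v : ℝ | 1 ≤ |v|}.indicator (fun _ => maxIncrement N i η x) v
              ∂gaussianReal 0 1 := by
            rw [integral_indicator_const _ hm, smul_eq_mul, mul_comm, gaussianTailMass]
        _ ≤ _ := by
            refine integral_mono ((integrable_const _).indicator hm) hx fun v => ?_
            refine Set.indicator_le' (fun v hv => ?_) (fun v _ =>
              hN.dilationIncrement_nonneg i hη _) v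
            exact hN.maxIncrement_le_dilationIncrement x i hη hv
              ((not_le.1 h).le.trans hv)
    have h2 := hN.dilationIncrement_nonneg i hη x
    have h3 : maxIncrement N i η x ≤ gaussianTailMass⁻¹ *
        ∫ v, dilationIncrement N i η (Function.update x i v) ∂gaussianReal 0 1 := by
      rw [le_inv_mul_iff₀ hp, mul_comm]
      exact h1
    linarith

end IsUnconditionalNorm

/-- The constant in the bound on the influences in the position of minimal `M`. -/
noncomputable def influenceConst : ℝ := 3 * (1 + gaussianTailMass⁻¹)

lemma influenceConst_pos : 0 < influenceConst := by
  have := gaussianTailMass_pos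
  unfold influenceConst
  positivity

lemma IsUnconditionalNorm.exists_integral_maxIncrement_le {n : ℕ} {N : (Fin n → ℝ) → ℝ}
    (hN : IsUnconditionalNorm N) (hM : MinimalMPosition n N) (i : Fin n) :
    ∃ η : ℝ, 0 < η ∧ ∫ x, maxIncrement N i η x ∂_root_.stdGaussian n ≤
      η * (influenceConst * ((∫ x, N x ∂_root_.stdGaussian n) / n)) := by
  obtain ⟨η, hη, h⟩ := hN.exists_integral_dilationIncrement_le hM i
  refine ⟨η, hη, ?_⟩
  have hp := gaussianTailMass_pos
  have hS := hN.integrable_dilationIncrement i η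
  have hSu := integrable_comp_update i hS
  have h1 : ∀ᵐ x ∂_root_.stdGaussian n, maxIncrement N i η x ≤
      dilationIncrement N i η x + gaussianTailMass⁻¹ *
      ∫ v, dilationIncrement N i η (Function.update x i v) ∂gaussianReal 0 1 := by
    filter_upwards [hSu.prod_right_ae] with x hx
    exact hN.maxIncrement_le_add_integral i hη x hx
  have hK : Integrable (maxIncrement N i η) (_root_.stdGaussian n) := by
    refine (integrable_const (bConst N * η)).mono'
      (hN.continuous_maxIncrement i η).aestronglyMeasurable (ae_of_all _ fun x => ?_)
    rw [Real.norm_of_nonneg (hN.maxIncrement_nonneg i hη.le x)]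
    exact hN.maxIncrement_le i hη.le x
  have hI := hSu.integral_prod_left
  refine (integral_mono_ae hK (hS.add (hI.const_mul _)) h1).trans ?_
  simp only [Pi.add_apply]
  rw [integral_add hS (hI.const_mul _), integral_const_mul, ← integral_eq_integral_update i hS]
  have h2 : 0 < 1 + gaussianTailMass⁻¹ := by positivity
  calc _ = (1 + gaussianTailMass⁻¹) * ∫ x, dilationIncrement N i η x ∂_root_.stdGaussian n := by ring
    _ ≤ _ := mul_le_mul_of_nonneg_left h h2.le
    _ = _ := by unfold influenceConst; ring

end Influence

/-! ### Gaussian limit of normalized sign sums -/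

section SignSums

open Filter Topology

/-- The sign `±1` encoded by a Boolean. -/
def boolSign (b : Bool) : ℝ := if b then 1 else -1

lemma boolSign_sq (b : Bool) : boolSign b * boolSign b = 1 := by
  cases b <;> simp [boolSign]

lemma boolSign_not (b : Bool) : boolSign (!b) = -boolSign b := by
  cases b <;> simp [boolSign]

/-- The vector of normalized sums of the rows of an `n × m` array of signs. -/
noncomputable def signSum (n m : ℕ) (x : Fin n × Fin m → Bool) : Fin n → ℝ :=
  fun i => (√m)⁻¹ * ∑ j, boolSign (x (i, j))

/-- The law of a fair coin. -/
noncomputable def coin : Measure Bool := (PMF.uniformOfFintype Bool).toMeasure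

instance : IsProbabilityMeasure coin := by
  unfold coin
  infer_instance

lemma coin_real_singleton (b : Bool) : coin.real {b} = 1 / 2 := by
  rw [Measure.real, coin, PMF.toMeasure_apply_singleton _ _ (measurableSet_singleton b),
    PMF.uniformOfFintype_apply]
  simp

lemma integral_coin (f : Bool → ℝ) : ∫ b, f b ∂coin = (f true + f false) / 2 := by
  rw [integral_fintype .of_finite]
  simp [coin_real_singleton]
  ring

lemma integral_pi_coin {ι : Type*} [Fintype ι] [DecidableEq ι] (f : (ι → Bool) → ℝ) :
    ∫ x, f x ∂(Measure.pi fun _ : ι => coin) = 𝔼 x, f x := by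
  rw [integral_fintype .of_finite, Fintype.expect_eq_sum_div_card, Finset.sum_div]
  refine Finset.sum_congr rfl fun x _ => ?_
  have h : (Measure.pi fun _ : ι => coin).real {x} = ((2 : ℝ) ^ Fintype.card ι)⁻¹ := by
    rw [Measure.real, Measure.pi_singleton, ENNReal.toReal_prod]
    have : ∀ i, (coin {x i}).toReal = 1 / 2 := fun i => coin_real_singleton (x i)
    simp [this]
  rw [h, smul_eq_mul]
  simp
  ring

/-- The law of the vector of normalized sign sums, as a measure on Euclidean space. -/
noncomputable def signSumLaw (n m : ℕ) : Measure (EuclideanSpace ℝ (Fin n)) :=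
  (Measure.pi fun _ : Fin n × Fin m => coin).map fun x => WithLp.toLp 2 (signSum n m x)

instance (n m : ℕ) : IsProbabilityMeasure (signSumLaw n m) :=
  Measure.isProbabilityMeasure_map (measurable_of_finite _).aemeasurable

/-- The standard Gaussian measure on Euclidean space. -/
noncomputable def euclGaussian (n : ℕ) : Measure (EuclideanSpace ℝ (Fin n)) :=
  (_root_.stdGaussian n).map (WithLp.toLp 2)

instance (n : ℕ) : IsProbabilityMeasure (euclGaussian n) :=
  Measure.isProbabilityMeasure_map (by fun_prop)

lemma charFun_signSumLaw (n m : ℕ) (t : EuclideanSpace ℝ (Fin n)) :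
    charFun (signSumLaw n m) t = ∏ i, charFun (coin.map boolSign) ((√m)⁻¹ * t i) ^ m := by
  have h1 : ∀ s : ℝ, charFun (coin.map boolSign) s =
      ∫ b, Complex.exp (s * boolSign b * Complex.I) ∂coin := fun s => by
    rw [charFun_apply_real, integral_map (measurable_of_finite _).aemeasurable
      (Measurable.aestronglyMeasurable (by fun_prop))]
  rw [charFun_apply, signSumLaw, integral_map (measurable_of_finite _).aemeasurable
    (Measurable.aestronglyMeasurable (by fun_prop))]
  have h2 : ∀ x : Fin n × Fin m → Bool,
      Complex.exp ((inner ℝ (WithLp.toLp 2 (signSum n m x)) t : ℝ) * Complex.I) =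
      ∏ k, Complex.exp ((((√m)⁻¹ * t k.1 : ℝ) : ℂ) * boolSign (x k) * Complex.I) := fun x => by
    rw [← Complex.exp_sum, ← Finset.sum_mul, Fintype.sum_prod_type, PiLp.inner_apply]
    congr 2
    rw [Complex.ofReal_sum]
    refine Finset.sum_congr rfl fun i _ => ?_
    simp only [signSum, ← Finset.mul_sum, Real.inner_apply]
    push_cast
    ring
  simp_rw [h2]
  rw [integral_fintype_prod_eq_prod (fun (k : Fin n × Fin m) b =>
    Complex.exp ((((√m)⁻¹ * t k.1 : ℝ) : ℂ) * boolSign b * Complex.I)), Fintype.prod_prod_type]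
  simp_rw [← h1]
  simp

lemma tendsto_charFun_signSumLaw (n : ℕ) (t : EuclideanSpace ℝ (Fin n)) :
    Tendsto (fun m => charFun (signSumLaw n m) t) atTop (𝓝 (charFun (euclGaussian n) t)) := by
  simp_rw [charFun_signSumLaw]
  rw [euclGaussian, _root_.stdGaussian, charFun_pi]
  refine tendsto_finsetProd _ fun i _ => ?_
  have h := tendsto_charFun_inv_sqrt_mul_pow (P := coin) (X := boolSign)
    (measurable_of_finite _).aemeasurable (by rw [integral_coin]; simp [boolSign])
    (by rw [integral_coin]; norm_num [boolSign]) (t i)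
  rw [charFun_gaussianReal]
  simpa [neg_div] using h

/-- The law of the vector of normalized sign sums, as a probability measure. -/
noncomputable def signSumProb (n m : ℕ) : ProbabilityMeasure (EuclideanSpace ℝ (Fin n)) :=
  ⟨signSumLaw n m, inferInstance⟩

/-- The standard Gaussian measure on Euclidean space, as a probability measure. -/
noncomputable def euclGaussianProb (n : ℕ) : ProbabilityMeasure (EuclideanSpace ℝ (Fin n)) :=
  ⟨euclGaussian n, inferInstance⟩

lemma tendsto_signSumProb (n : ℕ) : Tendsto (signSumProb n) atTop (𝓝 (euclGaussianProb n)) :=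
  ProbabilityMeasure.tendsto_iff_tendsto_charFun.2 (tendsto_charFun_signSumLaw n)

lemma tendsto_expect_signSum_of_bounded {n : ℕ} {f : (Fin n → ℝ) → ℝ} (hf : Continuous f) {A : ℝ}
    (hA : ∀ x, |f x| ≤ A) :
    Tendsto (fun m => 𝔼 x, f (signSum n m x)) atTop (𝓝 (∫ x, f x ∂_root_.stdGaussian n)) := by
  have hc : Continuous fun x : EuclideanSpace ℝ (Fin n) => f (WithLp.ofLp x) := by fun_prop
  have h := ProbabilityMeasure.tendsto_iff_forall_integral_tendsto.1 (tendsto_signSumProb n)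
    (BoundedContinuousFunction.ofNormedAddCommGroup (fun x => f (WithLp.ofLp x)) hc A
      fun x => hA _)
  simp only [signSumProb, euclGaussianProb, ProbabilityMeasure.coe_mk, BoundedContinuousFunction.coe_ofNormedAddCommGroup] at h
  rw [euclGaussian, integral_map (by fun_prop) hc.aestronglyMeasurable] at h
  refine h.congr fun m => ?_
  rw [signSumLaw, integral_map (measurable_of_finite _).aemeasurable hc.aestronglyMeasurable,
    integral_pi_coin]

open Classical in
lemma stdGaussian_le_of_eventually_expect_le {n : ℕ} {U : Set (Fin n → ℝ)} (hU : IsOpen U) {c : ℝ}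
    (h : ∀ᶠ m in atTop, 𝔼 x, (if signSum n m x ∈ U then (1 : ℝ) else 0) ≤ c) :
    _root_.stdGaussian n U ≤ ENNReal.ofReal c := by
  have hV : IsOpen ((WithLp.ofLp : EuclideanSpace ℝ (Fin n) → Fin n → ℝ) ⁻¹' U) :=
    hU.preimage (by fun_prop)
  have h1 := ProbabilityMeasure.le_liminf_measure_open_of_tendsto (tendsto_signSumProb n) hV
  simp only [signSumProb, euclGaussianProb, ProbabilityMeasure.coe_mk] at h1
  rw [euclGaussian, Measure.map_apply (by fun_prop) hV.measurableSet] at h1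
  refine h1.trans (liminf_le_of_frequently_le' (h.mono fun m hm => ?_).frequently)
  rw [signSumLaw, Measure.map_apply (measurable_of_finite _) hV.measurableSet]
  refine le_trans (le_of_eq ?_) (ENNReal.ofReal_le_ofReal hm)
  rw [← integral_pi_coin]
  have : ∀ x, (if signSum n m x ∈ U then (1 : ℝ) else 0) =
      (signSum n m ⁻¹' U).indicator 1 x := fun x => by simp [Set.indicator_apply]
  simp_rw [this]
  rw [integral_indicator_one (Set.toFinite _).measurableSet, Measure.real,
    ENNReal.ofReal_toReal (measure_ne_top _ _)]
  rfl

lemma expect_boolSign_mul {ι : Type*} [Fintype ι] [DecidableEq ι] (k l : ι) :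
    𝔼 x : ι → Bool, boolSign (x k) * boolSign (x l) = if k = l then 1 else 0 := by
  split_ifs with h
  · subst h
    simp [boolSign_sq]
  · have h1 := expect_flipAt k fun x : ι → Bool => boolSign (x k) * boolSign (x l)
    have h2 : ∀ x : ι → Bool, boolSign (flipAt k x k) * boolSign (flipAt k x l) =
        -(boolSign (x k) * boolSign (x l)) := fun x => by
      rw [flipAt, Function.update_self, Function.update_of_ne (Ne.symm h), boolSign_not, neg_mul]
    simp_rw [h2, Finset.expect_neg_distrib] at h1
    linarith

lemma expect_euclNorm_signSum_sq_le (n m : ℕ) :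
    𝔼 x, euclNorm (signSum n m x) ^ 2 ≤ n := by
  simp_rw [euclNorm_sq]
  rw [Finset.expect_sum_comm]
  have h : ∀ i : Fin n, 𝔼 x, signSum n m x i ^ 2 ≤ 1 := fun i => by
    have h1 : ∀ x, signSum n m x i ^ 2 =
        (m : ℝ)⁻¹ * ∑ j, ∑ j', boolSign (x (i, j)) * boolSign (x (i, j')) := fun x => by
      rw [signSum, mul_pow, inv_pow, Real.sq_sqrt (Nat.cast_nonneg m), sq, Finset.sum_mul_sum]
    simp_rw [h1, ← Finset.mul_expect, Finset.expect_sum_comm, expect_boolSign_mul]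
    simp only [Prod.mk.injEq, true_and, Finset.sum_ite_eq, Finset.mem_univ, if_true,
      Finset.sum_const, Finset.card_univ, Fintype.card_fin, nsmul_eq_mul, mul_one]
    exact inv_mul_le_one
  exact (Finset.sum_le_sum fun i _ => h i).trans (by simp)

lemma IsUnconditionalNorm.tendsto_expect_signSum {n : ℕ} {N : (Fin n → ℝ) → ℝ}
    (hN : IsUnconditionalNorm N) :
    Tendsto (fun m => 𝔼 x, N (signSum n m x)) atTop (𝓝 (∫ x, N x ∂_root_.stdGaussian n)) := by
  set B := bConst N ^ 2 * n with hB
  have hB0 : 0 ≤ B := by positivity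
  have trunc : ∀ (A : ℝ), 0 < A → ∀ x, N x - min (N x) A ≤ bConst N ^ 2 / A * euclNorm x ^ 2 := by
    intro A hA x
    have h1 : N x ^ 2 ≤ bConst N ^ 2 * euclNorm x ^ 2 := by
      rw [← mul_pow]
      exact pow_le_pow_left₀ (hN.nonneg x) (hN.le_bConst_mul x) 2
    rw [div_mul_eq_mul_div, le_div_iff₀ hA]
    refine le_trans ?_ h1
    rcases le_total (N x) A with h | h
    · rw [min_eq_left h, sub_self, zero_mul]
      positivity
    · rw [min_eq_right h]
      nlinarith
  refine Metric.tendsto_atTop'.2 fun ε hε => ?_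
  set A := 2 * (B + 1) / ε with hA
  have hA0 : 0 < A := by positivity
  have hBA : B / A < ε / 2 := by
    rw [hA, div_div_eq_mul_div, div_lt_div_iff₀ (by positivity) two_pos]
    nlinarith
  have hm := hN.continuous
  have h := tendsto_expect_signSum_of_bounded (f := fun x => min (N x) A) (by fun_prop) (A := A)
    fun x => by
      rw [abs_of_nonneg (le_min (hN.nonneg x) hA0.le)]
      exact min_le_right _ _
  obtain ⟨M, hM⟩ := Metric.tendsto_atTop'.1 h (ε / 2) (by positivity)
  refine ⟨M, fun m hmM => ?_⟩
  have h1 := hM m hmM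
  have h2 : 𝔼 x, min (N (signSum n m x)) A ≤ 𝔼 x, N (signSum n m x) :=
    Finset.expect_le_expect fun x _ => min_le_left _ _
  have h3 : 𝔼 x, N (signSum n m x) - 𝔼 x, min (N (signSum n m x)) A ≤ B / A := by
    rw [← Finset.expect_sub_distrib]
    refine (Finset.expect_le_expect fun x _ => trunc A hA0 _).trans ?_
    rw [← Finset.mul_expect, hB, mul_div_right_comm]
    exact mul_le_mul_of_nonneg_left (expect_euclNorm_signSum_sq_le n m) (by positivity)
  have hI : Integrable (fun x => min (N x) A) (_root_.stdGaussian n) :=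
    hN.integrable.inf (integrable_const A)
  have h4 : ∫ x, min (N x) A ∂_root_.stdGaussian n ≤ ∫ x, N x ∂_root_.stdGaussian n :=
    integral_mono hI hN.integrable fun x => min_le_left _ _
  have h5 : ∫ x, N x ∂_root_.stdGaussian n - ∫ x, min (N x) A ∂_root_.stdGaussian n ≤ B / A := by
    rw [← integral_sub hN.integrable hI]
    refine (integral_mono (hN.integrable.sub hI) (integrable_euclNorm_sq.const_mul _)
      (trunc A hA0)).trans_eq ?_
    rw [integral_const_mul, integral_euclNorm_sq, hB, mul_div_right_comm]
  rw [Real.dist_eq, abs_lt] at h1 ⊢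
  constructor <;> linarith [h1.1, h1.2]

end SignSums

/-! ### Concentration of an unconditional norm -/

section NormConcentration

open Filter Topology

lemma signSum_flipAt {n m : ℕ} (i : Fin n) (j : Fin m) (x : Fin n × Fin m → Bool) :
    signSum n m (flipAt (i, j) x) = Function.update (signSum n m x) i
      (signSum n m x i - 2 * (√m)⁻¹ * boolSign (x (i, j))) := by
  ext i'
  rcases eq_or_ne i' i with rfl | h
  · have h : ∀ j', boolSign (flipAt (i', j) x (i', j')) =
        boolSign (x (i', j')) - if j' = j then 2 * boolSign (x (i', j)) else 0 := fun j' => by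
      rcases eq_or_ne j' j with rfl | hj
      · rw [flipAt, Function.update_self, boolSign_not, if_pos rfl]
        ring
      · rw [flipAt, Function.update_of_ne (by simp [hj]), if_neg hj, sub_zero]
    simp only [signSum, h, Finset.sum_sub_distrib, Function.update_self, Finset.sum_ite_eq',
      Finset.mem_univ, if_true]
    ring
  · rw [Function.update_of_ne h]
    simp [signSum, flipAt, h]

lemma inv_sqrt_sq_mul {m : ℕ} (hm : 1 ≤ m) : (m : ℝ) * ((√m)⁻¹) ^ 2 = 1 := by
  have : (0 : ℝ) < m := by exact_mod_cast hm
  rw [inv_pow, Real.sq_sqrt this.le, mul_inv_cancel₀ this.ne']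

lemma eventually_exp_mul_inv_sqrt_le (r : ℝ) :
    ∀ᶠ m : ℕ in atTop, exp (r * (√m)⁻¹) ≤ 2 := by
  have h1 : Tendsto (fun m : ℕ => (√(m : ℝ))⁻¹) atTop (𝓝 0) :=
    tendsto_inv_atTop_zero.comp (Real.tendsto_sqrt_atTop.comp tendsto_natCast_atTop_atTop)
  have h2 : Tendsto (fun m : ℕ => exp (r * (√(m : ℝ))⁻¹)) atTop (𝓝 1) := by
    have := (Real.continuous_exp.tendsto _).comp (h1.const_mul r)
    simpa [Function.comp_def] using this
  exact h2.eventually_le_const one_lt_two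

namespace IsUnconditionalNorm

variable {n : ℕ} {N : (Fin n → ℝ) → ℝ}

/-- The bound for the decrease of `N` under a flip of one sign. -/
noncomputable def signDecrease (hN : IsUnconditionalNorm N) (m : ℕ) (k : Fin n × Fin m)
    (x : Fin n × Fin m → Bool) : ℝ :=
  (√m)⁻¹ * |hN.subgradient (signSum n m x) k.1|

lemma isDecreaseBound (hN : IsUnconditionalNorm N) (m : ℕ) :
    IsDecreaseBound (fun x => N (signSum n m x)) (hN.signDecrease m) (bConst N * (√m)⁻¹) := by
  have hs : ∀ (i : Fin n) (j : Fin m) (x : Fin n × Fin m → Bool),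
      |signSum n m x i - 2 * (√m)⁻¹ * boolSign (x (i, j)) - signSum n m x i| = 2 * (√m)⁻¹ := by
    intro i j x
    have hb : |boolSign (x (i, j))| = 1 := by
      cases x (i, j) <;> simp [boolSign]
    rw [sub_sub_cancel_left, abs_neg, abs_mul, hb, mul_one, abs_of_nonneg (by positivity)]
  refine ⟨fun k x => by unfold signDecrease; positivity, ?_, ?_⟩
  · rintro ⟨i, j⟩ x
    have h := hN.sub_update_le (signSum n m x) i
      (signSum n m x i - 2 * (√m)⁻¹ * boolSign (x (i, j)))
    rw [← signSum_flipAt, hs] at h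
    refine h.trans_eq ?_
    unfold signDecrease
    ring
  · rintro ⟨i, j⟩ x
    have h := hN.abs_sub_update_le (signSum n m x) i
      (signSum n m x i - 2 * (√m)⁻¹ * boolSign (x (i, j)))
    rw [← signSum_flipAt, hs] at h
    exact h.trans_eq (by ring)

lemma sum_signDecrease_sq_le (hN : IsUnconditionalNorm N) {m : ℕ} (hm : 1 ≤ m)
    (x : Fin n × Fin m → Bool) : ∑ k, hN.signDecrease m k x ^ 2 ≤ bConst N ^ 2 := by
  refine le_trans (le_of_eq ?_) (hN.sum_subgradient_sq_le (signSum n m x))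
  rw [Fintype.sum_prod_type]
  refine Finset.sum_congr rfl fun i _ => ?_
  simp only [signDecrease, mul_pow, sq_abs, Finset.sum_const, Finset.card_univ, Fintype.card_fin,
    nsmul_eq_mul]
  rw [← mul_assoc, inv_sqrt_sq_mul hm, one_mul]

lemma sum_signDecrease_le (hN : IsUnconditionalNorm N) (m : ℕ) (x : Fin n × Fin m → Bool) :
    ∑ k, hN.signDecrease m k x ≤ m * (√m)⁻¹ * (√n * bConst N) := by
  refine le_trans (le_of_eq ?_) (mul_le_mul_of_nonneg_left
    (hN.sum_abs_subgradient_le (signSum n m x)) (by positivity))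
  rw [Fintype.sum_prod_type, Finset.mul_sum]
  simp [signDecrease, mul_assoc]

lemma eventually_expect_subgradient_le (hN : IsUnconditionalNorm N)
    (hM : MinimalMPosition n N) :
    ∀ᶠ m in atTop, ∀ i, 𝔼 x, |hN.subgradient (signSum n m x) i| ≤
      2 * influenceConst * ((∫ x, N x ∂_root_.stdGaussian n) / n) := by
  refine eventually_all.2 fun i => ?_
  obtain ⟨η, hη, h⟩ := hN.exists_integral_maxIncrement_le hM i
  have hC := influenceConst_pos
  have hE := hN.integral_pos i.pos
  have hn : (0 : ℝ) < n := by exact_mod_cast i.pos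
  have h1 := tendsto_expect_signSum_of_bounded (hN.continuous_maxIncrement i η)
    (A := bConst N * η) fun x => by
      rw [abs_of_nonneg (hN.maxIncrement_nonneg i hη.le x)]
      exact hN.maxIncrement_le i hη.le x
  set E := ∫ x, N x ∂_root_.stdGaussian n
  have h2 : ∫ x, maxIncrement N i η x ∂_root_.stdGaussian n <
      η * (2 * influenceConst * (E / n)) := by
    refine h.trans_lt (mul_lt_mul_of_pos_left ?_ hη)
    have : 0 < influenceConst * (E / n) := by positivity
    linarith
  filter_upwards [h1.eventually_le_const h2] with m hm
  refine le_of_mul_le_mul_left (le_trans ?_ hm) hη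
  rw [Finset.mul_expect]
  exact Finset.expect_le_expect fun x _ => hN.mul_abs_subgradient_le i _

lemma stdGaussian_deviation_le (hN : IsUnconditionalNorm N) {s c : ℝ} (hs : 0 < s)
    (h : ∀ᶠ m in atTop, 𝔼 x, (if s / 2 < |N (signSum n m x) - 𝔼 y, N (signSum n m y)|
      then (1 : ℝ) else 0) ≤ c) :
    _root_.stdGaussian n {x | s < |N x - ∫ y, N y ∂_root_.stdGaussian n|} ≤ ENNReal.ofReal c := by
  have hc := hN.continuous
  refine stdGaussian_le_of_eventually_expect_le (isOpen_lt continuous_const (by fun_prop)) ?_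
  have h1 := Metric.tendsto_nhds.1 hN.tendsto_expect_signSum (s / 2) (half_pos hs)
  filter_upwards [h, h1] with m hm hm1
  refine le_trans (Finset.expect_le_expect fun x _ => ?_) hm
  rw [Real.dist_eq] at hm1
  split_ifs with h2 h3
  · exact le_rfl
  · refine absurd ?_ h3
    have h4 : s < |N (signSum n m x) - ∫ y, N y ∂_root_.stdGaussian n| := h2
    have := _root_.abs_sub_le (N (signSum n m x)) (𝔼 y, N (signSum n m y))
      (∫ y, N y ∂_root_.stdGaussian n)
    linarith
  · exact zero_le_one
  · exact le_rfl

lemma gaussian_deviation_le (hN : IsUnconditionalNorm N) (hn : 1 ≤ n) {s : ℝ} (hs : 0 < s) :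
    _root_.stdGaussian n {x | s < |N x - ∫ y, N y ∂_root_.stdGaussian n|} ≤
      ENNReal.ofReal (2 * exp (-(s ^ 2 / (192 * bConst N ^ 2)))) := by
  have hb := hN.bConst_pos hn
  refine hN.stdGaussian_deviation_le hs ?_
  filter_upwards [eventually_ge_atTop 1,
    eventually_exp_mul_inv_sqrt_le (2 * (s / 2 / (24 * bConst N ^ 2)) * bConst N)] with m hm hm2
  have h := (hN.isDecreaseBound m).gaussian_tail (s := s / 2) (V := bConst N ^ 2) (half_pos hs)
    (by positivity) (hN.sum_signDecrease_sq_le hm) (by rwa [← mul_assoc]) (by positivity)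
  refine h.trans_eq ?_
  congr 3
  field_simp
  norm_num

lemma exponential_deviation_le (hN : IsUnconditionalNorm N) (hn : 1 ≤ n)
    (hM : MinimalMPosition n N) {s l Λ : ℝ} (hs : 0 < s) (hl : 0 < l)
    (hlR : l ≤ log (√n * bConst N / ∫ y, N y ∂_root_.stdGaussian n) + 1) (hΛ0 : 0 < Λ)
    (hΛ : (12 + 6 * influenceConst) * bConst N ^ 2 / l * Λ ^ 2 ≤ 1 / 2) :
    _root_.stdGaussian n {x | s < |N x - ∫ y, N y ∂_root_.stdGaussian n|} ≤
      ENNReal.ofReal (2 * exp 2 * exp (-(Λ * (s / 2)))) := by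
  have hb := hN.bConst_pos hn
  have hC := influenceConst_pos
  have hE := hN.integral_pos hn
  have hn0 : (0 : ℝ) < n := by exact_mod_cast hn
  have hn1 : 0 < √(n : ℝ) := Real.sqrt_pos.2 hn0
  refine hN.stdGaussian_deviation_le hs ?_
  filter_upwards [eventually_ge_atTop 1, eventually_exp_mul_inv_sqrt_le (2 * Λ * bConst N),
    hN.eventually_expect_subgradient_le hM] with m hm hm2 hm3
  set E := ∫ y, N y ∂_root_.stdGaussian n
  have : Nonempty (Fin n × Fin m) := ⟨(⟨0, hn⟩, ⟨0, hm⟩)⟩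
  refine (hN.isDecreaseBound m).exponential_tail (V := bConst N ^ 2)
    (a := (√m)⁻¹ * (2 * influenceConst * (E / n))) (S := m * (√m)⁻¹ * (√n * bConst N))
    (R := √n * bConst N / E) (A := 2 * influenceConst) (l := l)
    (by positivity) (hN.sum_signDecrease_sq_le hm) (fun k => ?_) (hN.sum_signDecrease_le m)
    (by positivity) (by positivity) (le_of_eq ?_) hl hlR hΛ0 ?_ (by rwa [← mul_assoc])
    (by positivity)
  · simp only [signDecrease]
    rw [← Finset.mul_expect]
    exact mul_le_mul_of_nonneg_left (hm3 k.1) (by positivity)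
  · calc _ = (m * ((√m)⁻¹) ^ 2) * (√n ^ 2 / n) * (2 * influenceConst * bConst N ^ 2) * (E / E) := by
          ring
      _ = _ := by
          rw [inv_sqrt_sq_mul hm, Real.sq_sqrt hn0.le, div_self hn0.ne', div_self hE.ne']
          ring
  · rwa [show 12 + 3 * (2 * influenceConst) = 12 + 6 * influenceConst by ring]

lemma log_deviation_le (hN : IsUnconditionalNorm N) (hn : 1 ≤ n) (hM : MinimalMPosition n N)
    {t : ℝ} (ht : 0 < t) :
    _root_.stdGaussian n {x | t * (∫ y, N y ∂_root_.stdGaussian n) <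
        |N x - ∫ y, N y ∂_root_.stdGaussian n|} ≤
      ENNReal.ofReal (2 * exp 2 * exp (-(1 / (4 * √(12 + 6 * influenceConst)) *
        (t * √(critDim n N * log (exp 1 * n / critDim n N)))))) := by
  have hb := hN.bConst_pos hn
  have hC := influenceConst_pos
  have hE := hN.integral_pos hn
  have hEb := hN.integral_le hn
  have hn0 : (0 : ℝ) < n := by exact_mod_cast hn
  have hk : critDim n N = ((∫ x, N x ∂_root_.stdGaussian n) / bConst N) ^ 2 := rfl
  set E := ∫ x, N x ∂_root_.stdGaussian n with hEdef
  have hr0 : 0 < √n * bConst N / E := by positivity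
  have hr1 : 1 ≤ √n * bConst N / E := by
    rw [le_div_iff₀ hE]
    linarith
  have hR : exp 1 * n / critDim n N = exp 1 * (√n * bConst N / E) ^ 2 := by
    rw [hk, div_pow, div_pow, mul_pow, Real.sq_sqrt hn0.le]
    field_simp
  have hL : log (exp 1 * n / critDim n N) = 1 + 2 * log (√n * bConst N / E) := by
    rw [hR, Real.log_mul (Real.exp_ne_zero _) (by positivity), Real.log_exp, Real.log_pow]
    norm_num
  have hlog := Real.log_nonneg hr1
  set L := log (exp 1 * n / critDim n N) with hLdef
  have hL1 : 0 < L := by linarith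
  set D := 12 + 6 * influenceConst with hD
  have hD0 : 0 < D := by positivity
  have h := hN.exponential_deviation_le hn hM (s := t * E) (l := L / 2)
    (Λ := √L / (2 * √D * bConst N)) (by positivity) (by positivity)
    (by rw [hL]; linarith) (by positivity) (le_of_eq (by
      rw [div_pow, mul_pow, mul_pow, Real.sq_sqrt hL1.le, Real.sq_sqrt hD0.le]
      field_simp
      norm_num [hD]))
  refine h.trans_eq ?_
  congr 4
  rw [Real.sqrt_mul (by rw [hk]; positivity), hk, Real.sqrt_sq (by positivity)]
  field_simp
  norm_num

end IsUnconditionalNorm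

end NormConcentration

/-- For a 1-unconditional norm in position of minimal `M`, with `k = k(X)`:
`P(|N(G) − E N(G)| > t E N(G)) ≤ C exp(−c max{t² k, t √(k log(e n / k))})`. -/
theorem statement5 :
    ∃ C > (0 : ℝ), ∃ c > (0 : ℝ), ∀ n : ℕ, 1 ≤ n →
      ∀ N : (Fin n → ℝ) → ℝ,
        (∀ x y, N (x + y) ≤ N x + N y) →
        (∀ (r : ℝ) (x), N (r • x) = |r| * N x) →
        (∀ x, N x = 0 → x = 0) →
        (∀ ε : Fin n → ℝ, (∀ i, ε i = 1 ∨ ε i = -1) →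
          ∀ x : Fin n → ℝ, N (fun i => ε i * x i) = N x) →
        MinimalMPosition n N →
        ∀ t > (0 : ℝ),
          stdGaussian n
              {x | t * (∫ y, N y ∂stdGaussian n) < |N x - ∫ y, N y ∂stdGaussian n|}
            ≤ ENNReal.ofReal
                (C * Real.exp (-c * max (t ^ 2 * critDim n N)
                  (t * Real.sqrt (critDim n N *
                    Real.log (Real.exp 1 * n / critDim n N))))) := by
  have hC := influenceConst_pos
  have hD : 0 < 1 / (4 * √(12 + 6 * influenceConst)) := by positivity
  refine ⟨2 * exp 2, by positivity, min (1 / 192) (1 / (4 * √(12 + 6 * influenceConst))),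
    lt_min (by norm_num) hD, ?_⟩
  intro n hn N hadd hsmul hzero hsign hM t ht
  have hN : IsUnconditionalNorm N := ⟨hadd, hsmul, hzero, hsign⟩
  have hk0 : 0 ≤ critDim n N := sq_nonneg _
  rcases max_choice (t ^ 2 * critDim n N)
    (t * √(critDim n N * log (exp 1 * n / critDim n N))) with h | h <;> rw [h]
  · have hE := hN.integral_pos hn
    refine (hN.gaussian_deviation_le hn (mul_pos ht hE)).trans (ENNReal.ofReal_le_ofReal ?_)
    have h1 : (t * ∫ y, N y ∂_root_.stdGaussian n) ^ 2 / (192 * bConst N ^ 2) =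
        1 / 192 * (t ^ 2 * critDim n N) := by
      rw [critDim]
      ring
    have h2 : (1 : ℝ) ≤ exp 2 := Real.one_le_exp (by norm_num)
    rw [h1, neg_mul]
    gcongr
    · linarith
    · exact min_le_left _ _
  · refine (hN.log_deviation_le hn hM ht).trans (ENNReal.ofReal_le_ofReal ?_)
    rw [neg_mul]
    gcongr
    exact min_le_right _ _
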